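/- For every nonnegative integer k, the probability that a uniformly random tanglegram of size n has exactly k matched cherries AND has no automorphisms other than the 2^k automorphisms induced by interchanging the leaves within matched cherries converges, as n → ∞, to e^{−1/4}·4^{−k}/k!. Consequently, with high probability all automorphisms of a random tanglegram are induced by its matched cherries. -/

import Mathlib

open scoped Classical

inductive PTree : Type
  | leaf : PTree
  | node : PTree → PTree → PTree
deriving DecidableEq

namespace PTree

def size : PTree → ℕ
  | leaf => 1
  | node l r => size l + size r

def cherries : PTree → ℕ
  | leaf => 0
  | node leaf leaf => 1
  | node l r => cherries l + cherries r

def height : PTree → ℕ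
  | leaf => 0
  | node l r => max (height l) (height r) + 1

def encode : PTree → ℕ
  | leaf => 0
  | node l r => Nat.pair (encode l) (encode r) + 1

def normalize : PTree → PTree
  | leaf => leaf
  | node l r =>
      let l' := normalize l
      let r' := normalize r
      if encode l' ≤ encode r' then node l' r' else node r' l'

def isoFuns : PTree → PTree → List (ℕ → ℕ)
  | leaf, leaf => [fun i => i]
  | node l r, node l' r' =>
      ((isoFuns l l').flatMap fun g => (isoFuns r r').map fun h =>
        fun i => if i < l.size then g i else h (i - l.size) + l'.size)
      ++
      ((isoFuns l r').flatMap fun g => (isoFuns r l').map fun h =>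
        fun i => if i < l.size then g i + l'.size else h (i - l.size))
  | _, _ => []

def planeTrees : ℕ → Finset PTree
  | 0 => ∅
  | 1 => {leaf}
  | n + 2 =>
      (Finset.range (n + 1)).attach.biUnion fun k =>
        ((planeTrees (k.1 + 1)) ×ˢ (planeTrees (n + 1 - k.1))).image
          fun p => node p.1 p.2
  termination_by n => n
  decreasing_by
  · have := Finset.mem_range.mp k.2; omega
  · omega

def binTrees (n : ℕ) : Finset PTree := (planeTrees n).image normalize

/-- Triples (T, v, S): left plane tree, right plane tree, and a matching `v`
(a permutation of `0, …, n-1`, encoded as the list of its values) matching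
leaf `i` of `T` with leaf `v i` of `S`. -/
def Triples (n : ℕ) : Finset (PTree × PTree × List ℕ) :=
  (planeTrees n) ×ˢ ((planeTrees n) ×ˢ (List.range n).permutations.toFinset)

/-- Two triples represent the same tanglegram iff there are isomorphisms of the left
trees and of the right trees compatible with the matchings. -/
def equivTriple (n : ℕ) (t t' : PTree × PTree × List ℕ) : Bool :=
  (isoFuns t.1 t'.1).any fun φ => (isoFuns t.2.1 t'.2.1).any fun ψ =>
    (List.range n).all fun i => t'.2.2.getD (φ i) 0 == ψ (t.2.2.getD i 0)

/-- The tanglegrams of size `n`: equivalence classes of triples. -/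
def tangleClasses (n : ℕ) : Finset (Finset (PTree × PTree × List ℕ)) :=
  (Triples n).image fun t => (Triples n).filter (fun t' => equivTriple n t t' = true)

/-- The number of tanglegrams of size `n`. -/
def numTanglegrams (n : ℕ) : ℕ := (tangleClasses n).card

/-- The probability that a uniformly random tanglegram of size `n` satisfies the
(isomorphism-invariant) property `P` of triples. -/
noncomputable def tangleProb (n : ℕ) (P : PTree × PTree × List ℕ → Prop) : ℝ :=
  ((tangleClasses n).filter fun c => ∃ t ∈ c, P t).card / numTanglegrams n

/-- The expectation of the statistic `f` of a uniformly random tanglegram of size `n`. -/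
noncomputable def tangleExp (n : ℕ) (f : PTree × PTree × List ℕ → ℕ) : ℝ :=
  ∑' k : ℕ, (k : ℝ) * tangleProb n (fun t => f t = k)

end PTree

namespace PTree

/-- The distribution on pairs of binary trees (canonical representatives) induced by
the two halves of a uniformly random tanglegram of size `n`:
probability that the pair of isomorphism classes of the two trees lies in `S`. -/
noncomputable def nuT (n : ℕ) (S : Finset (PTree × PTree)) : ℝ :=
  tangleProb n fun t => (normalize t.1, normalize t.2.1) ∈ S

/-- The distribution on pairs of binary trees induced by two independent uniformly
random plane binary trees with `n` leaves. -/
noncomputable def nuP (n : ℕ) (S : Finset (PTree × PTree)) : ℝ :=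
  (((planeTrees n) ×ˢ (planeTrees n)).filter
      fun p => (normalize p.1, normalize p.2) ∈ S).card / ((planeTrees n).card ^ 2 : ℝ)

/-- The total variation distance between `nuT` and `nuP`. -/
noncomputable def tvDist (n : ℕ) : ℝ :=
  ((binTrees n ×ˢ binTrees n).powerset).sup' (Finset.powerset_nonempty _)
    fun S => |nuT n S - nuP n S|

/-- The number of occurrences of (trees isomorphic to) `B` as a fringe subtree of `T`. -/
def occ (B : PTree) : PTree → ℕ
  | leaf => if normalize leaf = normalize B then 1 else 0
  | node l r => (if normalize (node l r) = normalize B then 1 else 0) + occ B l + occ B r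

/-- The number of generators of the automorphism group of `T`: the number of internal
vertices whose two branches are isomorphic. -/
def gens : PTree → ℕ
  | leaf => 0
  | node l r => (if normalize l = normalize r then 1 else 0) + gens l + gens r

/-- `T` has a root branch isomorphic to `B`. -/
def hasBranch (B : PTree) : PTree → Prop
  | leaf => False
  | node l r => normalize l = normalize B ∨ normalize r = normalize B

/-- The cherries of a plane binary tree whose leaves are numbered from `k` on
(left to right), as pairs of leaf positions. -/
def cherryList : PTree → ℕ → List (ℕ × ℕ)
  | leaf, _ => []
  | node leaf leaf, k => [(k, k + 1)]
  | node l r, k => cherryList l k ++ cherryList r (k + l.size)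

/-- The number of matched cherries: cherries of `T` whose two leaves are matched by `L`
to the two leaves of a cherry of `S`. -/
def matchedCherries (T S : PTree) (L : List ℕ) : ℕ :=
  (cherryList T 0).countP fun p =>
    (cherryList S 0).any fun q =>
      (L.getD p.1 0 == q.1 && L.getD p.2 0 == q.2) ||
      (L.getD p.1 0 == q.2 && L.getD p.2 0 == q.1)

/-- The number of automorphisms of the tanglegram represented by the triple `(T, L, S)`:
pairs of automorphisms of the two trees compatible with the matching `L`. -/
def tangleAutCount (T S : PTree) (L : List ℕ) : ℕ :=
  ((isoFuns T T).map fun a =>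
    (isoFuns S S).countP fun b =>
      (List.range T.size).all fun i => L.getD (a i) 0 == b (L.getD i 0)).sum

/-- The number of automorphisms of `T` whose cycle type is `μ(s) = 2^s 1^(n-2s)`,
i.e. involutions of the leaves moving exactly `2 s` leaves. -/
def autMuCount (T : PTree) (s : ℕ) : ℕ :=
  (isoFuns T T).countP fun f =>
    ((List.range T.size).all fun i => f (f i) == i) &&
    ((List.range T.size).countP fun i => !(f i == i)) == 2 * s

end PTree

section Series

open Finset

/-- The number of plane binary trees with `m` leaves, as a real number. -/
noncomputable def planeCount (m : ℕ) : ℝ := if m = 0 then 0 else (catalan (m - 1) : ℝ)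

lemma planeCount_zero : planeCount 0 = 0 := by simp [planeCount]

lemma planeCount_succ (m : ℕ) : planeCount (m + 1) = catalan m := by simp [planeCount]

lemma planeCount_eq (m : ℕ) :
    planeCount m = (if m = 1 then 1 else 0) +
      ∑ p ∈ antidiagonal m, planeCount p.1 * planeCount p.2 := by
  rcases m with _ | _ | m
  · simp [planeCount]
  · simp [planeCount, Finset.Nat.antidiagonal_succ]
  · rw [planeCount_succ, catalan_succ', Finset.Nat.antidiagonal_succ, Finset.sum_cons,
      Finset.sum_map, Finset.Nat.antidiagonal_succ', Finset.sum_cons, Finset.sum_map]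
    simp [planeCount_zero, planeCount_succ]

/-- The series `X * (δ 0 + δ 1 X + δ 2 X ^ 2 + ⋯)` in the variable `Y X ^ 2`. -/
noncomputable def swapSeries (δ : ℕ → ℝ) : PowerSeries (Polynomial ℝ) :=
  PowerSeries.expand 2 two_ne_zero (PowerSeries.rescale Polynomial.X
    (PowerSeries.map Polynomial.C (PowerSeries.X * PowerSeries.mk δ)))

lemma coeff_swapSeries_pow (δ : ℕ → ℝ) (j n : ℕ) :
    PowerSeries.coeff n (swapSeries δ ^ j) =
      if 2 ∣ n then Polynomial.X ^ (n / 2) * Polynomial.C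
        (if j ≤ n / 2 then PowerSeries.coeff (n / 2 - j) (PowerSeries.mk δ ^ j) else 0)
      else 0 := by
  rw [swapSeries, ← map_pow, ← map_pow, ← map_pow, PowerSeries.coeff_expand]
  simp only [PowerSeries.coeff_rescale, PowerSeries.coeff_map, mul_pow,
    PowerSeries.coeff_X_pow_mul']

lemma coeff_swapSeries (δ : ℕ → ℝ) (n : ℕ) :
    PowerSeries.coeff n (swapSeries δ) =
      if 2 ∣ n ∧ n ≠ 0 then Polynomial.X ^ (n / 2) * Polynomial.C (δ (n / 2 - 1)) else 0 := by
  have := coeff_swapSeries_pow δ 1 n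
  rw [pow_one] at this
  rw [this]
  by_cases h : 2 ∣ n
  · obtain ⟨m, rfl⟩ := h
    rcases m with _ | m
    · simp
    · simp
  · simp [h]

lemma coeff_pow_eq_zero_of_lt {R : Type*} [CommRing R] {w : PowerSeries R}
    (hw : PowerSeries.coeff 0 w = 0) {n m : ℕ} (h : n < m) :
    PowerSeries.coeff n (w ^ m) = 0 := by
  have h1 : (PowerSeries.X : PowerSeries R) ∣ w := by
    rw [PowerSeries.X_dvd_iff]; simpa using hw
  have h2 : (PowerSeries.X : PowerSeries R) ^ m ∣ w ^ m := pow_dvd_pow_of_dvd h1 m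
  exact PowerSeries.X_pow_dvd_iff.mp h2 n h

/-- The solution of the functional equation `E = w + E ^ 2`, coefficientwise. -/
lemma coeff_of_quadratic {R : Type*} [CommRing R] [Algebra ℝ R] {w : PowerSeries R}
    (hw : PowerSeries.coeff 0 w = 0) (ε : ℕ → R) (h0 : ε 0 = 0)
    (hε : ∀ n, ε n = PowerSeries.coeff n w + ∑ p ∈ antidiagonal n, ε p.1 * ε p.2) (n : ℕ) :
    ε n = ∑ m ∈ range (n + 1), algebraMap ℝ R (planeCount m) * PowerSeries.coeff n (w ^ m) := by
  have ext_range : ∀ i N : ℕ, i ≤ N →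
      ∑ m ∈ range (i + 1), algebraMap ℝ R (planeCount m) * PowerSeries.coeff i (w ^ m) =
      ∑ m ∈ range (N + 1), algebraMap ℝ R (planeCount m) * PowerSeries.coeff i (w ^ m) := by
    intro i N h
    apply Finset.sum_subset (by intro x; simp; omega)
    intro x _ hx
    rw [coeff_pow_eq_zero_of_lt hw (by simpa using hx), mul_zero]
  induction n using Nat.strong_induction_on with
  | _ n ih =>
  rcases Nat.eq_zero_or_pos n with rfl | hn
  · simp [h0, planeCount_zero]
  have key : ∀ p ∈ antidiagonal n, ε p.1 * ε p.2 =
      ∑ q ∈ range (n + 1) ×ˢ range (n + 1),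
        algebraMap ℝ R (planeCount q.1 * planeCount q.2) *
          (PowerSeries.coeff p.1 (w ^ q.1) * PowerSeries.coeff p.2 (w ^ q.2)) := by
    rintro ⟨i, j⟩ hp
    rw [HasAntidiagonal.mem_antidiagonal] at hp
    simp only at hp ⊢
    rw [Finset.sum_product]
    simp only [map_mul]
    have fact : ∑ x ∈ range (n + 1), ∑ y ∈ range (n + 1),
        algebraMap ℝ R (planeCount x) * algebraMap ℝ R (planeCount y) *
          (PowerSeries.coeff i (w ^ x) * PowerSeries.coeff j (w ^ y)) =
        (∑ x ∈ range (n + 1), algebraMap ℝ R (planeCount x) * PowerSeries.coeff i (w ^ x)) *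
        (∑ y ∈ range (n + 1), algebraMap ℝ R (planeCount y) * PowerSeries.coeff j (w ^ y)) := by
      rw [Finset.sum_mul_sum]
      refine Finset.sum_congr rfl fun x _ => Finset.sum_congr rfl fun y _ => by ring
    rw [fact, ← ext_range i n (by omega), ← ext_range j n (by omega)]
    by_cases hi : i = 0
    · subst hi; simp [h0, planeCount_zero]
    by_cases hj : j = 0
    · subst hj; simp [h0, planeCount_zero]
    rw [← ih i (by omega), ← ih j (by omega)]
  rw [hε n, Finset.sum_congr rfl key, Finset.sum_comm]
  simp only [← Finset.mul_sum, ← PowerSeries.coeff_mul, ← pow_add]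
  have rhs : ∀ m ∈ range (n + 1), algebraMap ℝ R (planeCount m) * PowerSeries.coeff n (w ^ m) =
      (if m = 1 then PowerSeries.coeff n (w ^ m) else 0) +
      ∑ p ∈ antidiagonal m, algebraMap ℝ R (planeCount p.1 * planeCount p.2) *
        PowerSeries.coeff n (w ^ (p.1 + p.2)) := by
    intro m _
    rw [planeCount_eq m, map_add, add_mul]
    congr 1
    · split_ifs <;> simp
    · rw [map_sum, Finset.sum_mul]
      refine Finset.sum_congr rfl fun p hp => ?_
      rw [HasAntidiagonal.mem_antidiagonal.mp hp]
  rw [Finset.sum_congr rfl rhs, Finset.sum_add_distrib]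
  congr 1
  · rw [Finset.sum_ite_eq' (range (n + 1)) 1]
    simp [show 0 < n from hn]
  · rw [Finset.sum_sigma']
    symm
    apply Finset.sum_bij_ne_zero (fun (x : (_ : ℕ) × ℕ × ℕ) _ _ => x.2)
    · rintro ⟨m, p⟩ h _
      simp only [mem_sigma, mem_range, HasAntidiagonal.mem_antidiagonal, mem_product] at h ⊢
      omega
    · rintro ⟨m, p⟩ h _ ⟨m', p'⟩ h' _ e
      simp only [mem_sigma, mem_range, HasAntidiagonal.mem_antidiagonal] at h h'
      simp only at e
      subst e
      have : m = m' := by omega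
      subst this; rfl
    · rintro ⟨x, y⟩ _ hne
      refine ⟨⟨x + y, (x, y)⟩, ?_, hne, rfl⟩
      simp only [mem_sigma, mem_range, HasAntidiagonal.mem_antidiagonal, and_true]
      by_contra hlt
      exact hne (by rw [coeff_pow_eq_zero_of_lt hw (by simp only; omega), mul_zero])
    · intros; rfl

/-- The coefficient of `Y ^ k X ^ n` in the solution of `E = X + swapSeries δ + E ^ 2`. -/
noncomputable def quadCoeff (δ : ℕ → ℝ) (n k : ℕ) : ℝ :=
  if 2 * k ≤ n then ∑ j ∈ range (k + 1), planeCount (n - 2 * k + j) *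
    ((n - 2 * k + j).choose j * PowerSeries.coeff (k - j) (PowerSeries.mk δ ^ j)) else 0

lemma coeff_X_add_swapSeries_pow (δ : ℕ → ℝ) (m n k : ℕ) :
    (PowerSeries.coeff n ((PowerSeries.X + swapSeries δ) ^ m)).coeff k =
      if 2 * k ≤ n ∧ n ≤ m + 2 * k ∧ m + k ≤ n then
        ((m.choose (m + 2 * k - n) : ℝ) *
          PowerSeries.coeff (n - m - k) (PowerSeries.mk δ ^ (m + 2 * k - n))) else 0 := by
  rw [add_pow]
  simp only [map_sum, Polynomial.finsetSum_coeff]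
  have term : ∀ i ∈ range (m + 1),
      ((PowerSeries.coeff n) (PowerSeries.X ^ i * swapSeries δ ^ (m - i) *
        (m.choose i : PowerSeries (Polynomial ℝ)))).coeff k =
      if i + 2 * k = n ∧ m - i ≤ k then (m.choose i : ℝ) *
        PowerSeries.coeff (k - (m - i)) (PowerSeries.mk δ ^ (m - i)) else 0 := by
    intro i hi
    have e1 : (m.choose i : PowerSeries (Polynomial ℝ)) =
        PowerSeries.C (Polynomial.C (m.choose i : ℝ)) := by simp
    rw [e1, PowerSeries.coeff_mul_C, Polynomial.coeff_mul_C, PowerSeries.coeff_X_pow_mul',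
      coeff_swapSeries_pow]
    by_cases h1 : i ≤ n
    · rw [if_pos h1]
      by_cases h2 : 2 ∣ n - i
      · rw [if_pos h2, Polynomial.coeff_mul_C, Polynomial.coeff_X_pow]
        obtain ⟨q, hq⟩ := h2
        rw [hq, Nat.mul_div_cancel_left _ two_pos]
        by_cases h3 : k = q
        · subst h3
          have : i + 2 * k = n := by omega
          simp only [this, true_and, if_true, one_mul]
          split_ifs
          · ring
          · simp
        · rw [if_neg h3, if_neg (c := i + 2 * k = n ∧ m - i ≤ k) (by omega)]; simp
      · rw [if_neg h2, if_neg (by omega)]; simp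
    · rw [if_neg h1, if_neg (by omega)]; simp
  rw [Finset.sum_congr rfl term]
  split_ifs with h
  · rw [Finset.sum_eq_single (n - 2 * k)]
    · rw [if_pos (by omega), show m - (n - 2 * k) = m + 2 * k - n by omega,
        show k - (m + 2 * k - n) = n - m - k by omega]
      congr 2
      rw [← Nat.choose_symm (by omega), show m - (n - 2 * k) = m + 2 * k - n by omega]
    · intro i _ hne; rw [if_neg (by omega)]
    · intro hi; simp at hi; omega
  · apply Finset.sum_eq_zero
    intro i hi
    simp at hi
    rw [if_neg (by omega)]

lemma coeff_eq_quadCoeff (δ : ℕ → ℝ) (ε : ℕ → Polynomial ℝ) (h0 : ε 0 = 0)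
    (hε : ∀ n, ε n = ((if n = 1 then 1 else 0) +
      if 2 ∣ n ∧ n ≠ 0 then Polynomial.X ^ (n / 2) * Polynomial.C (δ (n / 2 - 1)) else 0) +
        ∑ p ∈ antidiagonal n, ε p.1 * ε p.2) (n k : ℕ) :
    (ε n).coeff k = quadCoeff δ n k := by
  have hw : PowerSeries.coeff 0 (PowerSeries.X + swapSeries δ) = 0 := by
    rw [map_add, coeff_swapSeries]; simp
  rw [coeff_of_quadratic hw ε h0 (by
    intro n; rw [map_add, coeff_swapSeries, PowerSeries.coeff_X]; exact hε n)]
  simp only [Polynomial.finsetSum_coeff, Polynomial.algebraMap_eq, Polynomial.coeff_C_mul,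
    coeff_X_add_swapSeries_pow, quadCoeff]
  by_cases h : 2 * k ≤ n
  · rw [if_pos h]
    symm
    apply Finset.sum_bij_ne_zero (fun j _ _ => n - 2 * k + j)
    · intro j hj _; simp at hj ⊢; omega
    · intro a _ _ b _ _ e; omega
    · intro m hm hne
      have hc : 2 * k ≤ n ∧ n ≤ m + 2 * k ∧ m + k ≤ n := by
        by_contra hc; rw [if_neg hc] at hne; simp at hne
      refine ⟨m + 2 * k - n, by simp; omega, ?_, by omega⟩
      rw [if_pos hc] at hne
      rwa [show n - 2 * k + (m + 2 * k - n) = m by omega,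
        show k - (m + 2 * k - n) = n - m - k by omega]
    · intro j hj _
      simp at hj
      rw [if_pos (by omega), show n - 2 * k + j + 2 * k - n = j by omega,
        show n - (n - 2 * k + j) - k = k - j by omega]
  · rw [if_neg h]
    apply Finset.sum_eq_zero
    intro m _
    rw [if_neg (by omega), mul_zero]

end Series

section Asymptotics

open Finset Filter Topology

lemma coeff_mk_pow_nonneg {δ : ℕ → ℝ} (hδ : ∀ i, 0 ≤ δ i) (i j : ℕ) :
    0 ≤ PowerSeries.coeff i (PowerSeries.mk δ ^ j) := by
  induction j generalizing i with
  | zero => rw [pow_zero, PowerSeries.coeff_one]; split_ifs <;> norm_num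
  | succ j ih =>
    rw [pow_succ, PowerSeries.coeff_mul]
    exact Finset.sum_nonneg fun p _ => mul_nonneg (ih _) (by simpa using hδ _)

lemma coeff_mk_pow_le {δ : ℕ → ℝ} (hδ : ∀ i, 0 ≤ δ i) (hδ' : ∀ i, δ i ≤ 16 ^ i) (i j : ℕ) :
    PowerSeries.coeff i (PowerSeries.mk δ ^ j) ≤ 32 ^ i * 2 ^ j := by
  induction j generalizing i with
  | zero => rw [pow_zero, PowerSeries.coeff_one]; split_ifs with h <;> simp [h]
  | succ j ih =>
    rw [pow_succ, PowerSeries.coeff_mul]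
    have h1 : ∀ p ∈ antidiagonal i, PowerSeries.coeff p.1 (PowerSeries.mk δ ^ j) *
        PowerSeries.coeff p.2 (PowerSeries.mk δ) ≤ 32 ^ i * 2 ^ j * (1 / 2) ^ p.2 := by
      intro p hp
      rw [HasAntidiagonal.mem_antidiagonal] at hp
      calc _ ≤ (32 ^ p.1 * 2 ^ j) * (16 : ℝ) ^ p.2 :=
            mul_le_mul (ih _) (by simpa using hδ' _) (by simpa using hδ _) (by positivity)
        _ = _ := by
            rw [← hp, pow_add, show (16 : ℝ) = 32 * (1 / 2) by norm_num, mul_pow]; ring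
    refine (Finset.sum_le_sum h1).trans ?_
    rw [← Finset.mul_sum, pow_succ, ← mul_assoc]
    gcongr
    rw [← Finset.Nat.sum_antidiagonal_swap, Finset.Nat.sum_antidiagonal_eq_sum_range_succ_mk]
    exact sum_geometric_two_le (i + 1)

lemma planeCount_pos {m : ℕ} (hm : 0 < m) : 0 < planeCount m := by
  obtain ⟨m, rfl⟩ := Nat.exists_eq_succ_of_ne_zero hm.ne'
  rw [Nat.succ_eq_add_one, planeCount_succ]
  have h := succ_mul_catalan_eq_centralBinom m
  have h2 := Nat.centralBinom_pos m
  have : 0 < catalan m := by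
    rcases Nat.eq_zero_or_pos (catalan m) with h0 | h0
    · rw [h0, mul_zero] at h; omega
    · exact h0
  exact_mod_cast this

lemma planeCount_nonneg (m : ℕ) : 0 ≤ planeCount m := by
  rcases Nat.eq_zero_or_pos m with rfl | h
  · rw [planeCount_zero]
  · exact (planeCount_pos h).le

lemma planeCount_succ_mul (m : ℕ) :
    planeCount (m + 2) * (m + 2) = 2 * (2 * m + 1) * planeCount (m + 1) := by
  have h1 := succ_mul_catalan_eq_centralBinom m
  have h2 := succ_mul_catalan_eq_centralBinom (m + 1)
  have h3 := Nat.succ_mul_centralBinom_succ m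
  rw [planeCount_succ, planeCount_succ]
  rw [← h1, ← h2] at h3
  have h4 : ((m : ℝ) + 1) * ((m + 1 + 1) * catalan (m + 1)) =
      2 * (2 * m + 1) * ((m + 1) * catalan m) := by exact_mod_cast h3
  have : ((m : ℝ) + 1) ≠ 0 := by positivity
  apply mul_left_cancel₀ this
  linear_combination h4

lemma planeCount_mono : Monotone planeCount := by
  apply monotone_nat_of_le_succ
  rintro (_ | m)
  · rw [planeCount_zero]; exact planeCount_nonneg _
  · have h := planeCount_succ_mul m
    have h2 := planeCount_pos (Nat.succ_pos m)
    have h3 : (0 : ℝ) ≤ m := Nat.cast_nonneg m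
    have h4 : planeCount (m + 1) * (m + 2) ≤ planeCount (m + 2) * (m + 2) := by
      rw [h]; nlinarith
    exact le_of_mul_le_mul_right h4 (by positivity)

lemma tendsto_linear_div (a b c d : ℝ) (hc : c ≠ 0) :
    Tendsto (fun n : ℕ => (a * n + b) / (c * n + d)) atTop (𝓝 (a / c)) := by
  have h1 : Tendsto (fun n : ℕ => (a + b / n) / (c + d / n)) atTop (𝓝 ((a + 0) / (c + 0))) := by
    apply Tendsto.div
    · exact tendsto_const_nhds.add (tendsto_const_div_atTop_nhds_zero_nat b)
    · exact tendsto_const_nhds.add (tendsto_const_div_atTop_nhds_zero_nat d)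
    · simpa using hc
  rw [add_zero, add_zero] at h1
  refine h1.congr' ?_
  filter_upwards [eventually_gt_atTop 0] with n hn
  have : (n : ℝ) ≠ 0 := by positivity
  rw [← mul_div_mul_right _ _ this]
  congr 1 <;> field_simp

lemma tendsto_planeCount_div (a : ℕ) :
    Tendsto (fun c => planeCount c / planeCount (c + a)) atTop (𝓝 ((1 / 4) ^ a)) := by
  induction a with
  | zero =>
    refine tendsto_const_nhds.congr' ?_
    filter_upwards [eventually_gt_atTop 0] with n hn
    rw [add_zero, div_self (planeCount_pos hn).ne', pow_zero]
  | succ a ih =>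
    have h1 : Tendsto (fun c => planeCount c / planeCount (c + 1)) atTop (𝓝 (1 / 4)) := by
      rw [← tendsto_add_atTop_iff_nat 1]
      have := tendsto_linear_div 1 2 4 2 (by norm_num)
      refine this.congr fun n => ?_
      have h := planeCount_succ_mul n
      have h2 := planeCount_pos (Nat.succ_pos n)
      have h3 := planeCount_pos (Nat.succ_pos (n + 1))
      have h4 : (0 : ℝ) ≤ n := Nat.cast_nonneg n
      rw [div_eq_div_iff (by positivity) h3.ne']
      linear_combination h
    rw [pow_succ]
    refine (ih.mul (h1.comp (tendsto_add_atTop_nat a))).congr' ?_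
    filter_upwards [eventually_gt_atTop 0] with n hn
    have h3 := planeCount_pos (show 0 < n + a by omega)
    simp only [Function.comp]
    rw [← add_assoc]
    field_simp

lemma tendsto_descFactorial_div (k a : ℕ) :
    Tendsto (fun c : ℕ => ((c + k).descFactorial k : ℝ) / (c + k + a).descFactorial k)
      atTop (𝓝 1) := by
  have h : Tendsto (fun c : ℕ => ∏ i ∈ range k, ((1 * c + (k - i : ℕ) : ℝ) /
      (1 * c + (k - i + a : ℕ)))) atTop (𝓝 (∏ i ∈ range k, ((1 : ℝ) / 1))) :=
    tendsto_finsetProd _ fun i _ => tendsto_linear_div _ _ _ _ one_ne_zero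
  simp only [div_one, prod_const_one] at h
  refine h.congr fun c => ?_
  rw [Finset.prod_div_distrib, Nat.descFactorial_eq_prod_range, Nat.descFactorial_eq_prod_range]
  push_cast
  congr 1 <;>
  · refine Finset.prod_congr rfl fun i hi => ?_
    rw [mem_range] at hi
    first
    | (rw [show c + k - i = c + (k - i) by omega]; push_cast; ring)
    | (rw [show c + k + a - i = c + (k - i + a) by omega]; push_cast; ring)

lemma choose_le_choose_add {c j k : ℕ} (h : j ≤ k) : (c + j).choose j ≤ (c + k).choose k := by
  rw [Nat.choose_symm_add.symm, Nat.choose_symm_add.symm]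
  exact Nat.choose_le_choose c (by omega)

lemma tendsto_choose_div {j k : ℕ} (h : j < k) :
    Tendsto (fun c : ℕ => ((c + j).choose j : ℝ) / (c + k).choose k) atTop (𝓝 0) := by
  obtain ⟨k, rfl⟩ : ∃ k', k = k' + 1 := ⟨k - 1, by omega⟩
  have hlim := tendsto_linear_div 0 (k + 1) 1 (k + 1) one_ne_zero
  rw [zero_div] at hlim
  refine squeeze_zero (fun c => by positivity) (fun c => ?_) hlim
  have h1 : ((c + j).choose j : ℝ) ≤ (c + k).choose k := by
    exact_mod_cast choose_le_choose_add (by omega)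
  have h2 : ((c + k + 1 : ℕ) : ℝ) * (c + k).choose k =
      (c + k + 1).choose (k + 1) * (k + 1 : ℕ) := by
    exact_mod_cast Nat.add_one_mul_choose_eq (c + k) k
  have h3 : 0 < ((c + k + 1).choose (k + 1) : ℝ) := by
    exact_mod_cast Nat.choose_pos (by omega)
  rw [← add_assoc, div_le_div_iff₀ h3 (by positivity)]
  push_cast at h2
  nlinarith

/-- The contribution of permutations with `k` two-cycles, relative to the number of triples. -/
noncomputable def pairTerm (δ : ℕ → ℝ) (k n : ℕ) : ℝ :=
  (n - 2 * k).factorial * 2 ^ k * k.factorial * quadCoeff δ n k ^ 2 /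
    (n.factorial * planeCount n ^ 2)

/-- `quadCoeff δ (c + 2 * k) k` divided by its natural order of magnitude. -/
noncomputable def relCoeff (δ : ℕ → ℝ) (k c : ℕ) : ℝ :=
  ∑ j ∈ range (k + 1), planeCount (c + j) / planeCount (c + 2 * k) *
    (((c + j).choose j / (c + k).choose k) *
      PowerSeries.coeff (k - j) (PowerSeries.mk δ ^ j))

lemma pairTerm_add (δ : ℕ → ℝ) (k c : ℕ) (hc : 0 < c + 2 * k) :
    pairTerm δ k (c + 2 * k) = 2 ^ k / k.factorial *
      (((c + k).descFactorial k : ℝ) / (c + k + k).descFactorial k) * relCoeff δ k c ^ 2 := by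
  have hp := planeCount_pos hc
  have h3 : 0 < ((c + k).choose k : ℝ) := by
    exact_mod_cast Nat.choose_pos (by omega)
  have e : quadCoeff δ (c + 2 * k) k =
      planeCount (c + 2 * k) * (c + k).choose k * relCoeff δ k c := by
    rw [quadCoeff, if_pos (by omega), relCoeff, Finset.mul_sum, Nat.add_sub_cancel]
    refine Finset.sum_congr rfl fun j _ => ?_
    field_simp
  have f1 : (c.factorial : ℝ) * (c + k).descFactorial k = (c + k).factorial := by
    have := Nat.factorial_mul_descFactorial (show k ≤ c + k by omega)
    rw [Nat.add_sub_cancel] at this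
    exact_mod_cast this
  have f2 : ((c + k).factorial : ℝ) * (c + k + k).descFactorial k = (c + 2 * k).factorial := by
    have := Nat.factorial_mul_descFactorial (show k ≤ c + k + k by omega)
    rw [Nat.add_sub_cancel, show c + k + k = c + 2 * k by ring] at this
    rw [show c + k + k = c + 2 * k by ring]
    exact_mod_cast this
  have f3 : ((c + k).choose k : ℝ) * k.factorial = (c + k).descFactorial k := by
    have := Nat.descFactorial_eq_factorial_mul_choose (c + k) k
    rw [this]; push_cast; ring
  have g1 : (0 : ℝ) < c.factorial := by exact_mod_cast Nat.factorial_pos _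
  have g2 : (0 : ℝ) < k.factorial := by exact_mod_cast Nat.factorial_pos _
  have g3 : (0 : ℝ) < (c + k).descFactorial k := by rw [← f3]; positivity
  have g4 : (0 : ℝ) < (c + k + k).descFactorial k := by
    exact_mod_cast Nat.descFactorial_pos.mpr (by omega)
  rw [pairTerm, e, ← f2, ← f1, Nat.add_sub_cancel, ← f3]
  field_simp

variable {δ : ℕ → ℝ}

lemma relCoeff_nonneg (hδ : ∀ i, 0 ≤ δ i) (k c : ℕ) : 0 ≤ relCoeff δ k c :=
  Finset.sum_nonneg fun j _ => mul_nonneg (div_nonneg (planeCount_nonneg _) (planeCount_nonneg _))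
    (mul_nonneg (by positivity) (coeff_mk_pow_nonneg hδ _ _))

lemma relCoeff_le (hδ : ∀ i, 0 ≤ δ i) (hδ' : ∀ i, δ i ≤ 16 ^ i) (k c : ℕ) :
    relCoeff δ k c ≤ 64 ^ k := by
  have h : ∀ j ∈ range (k + 1), planeCount (c + j) / planeCount (c + 2 * k) *
    (((c + j).choose j / (c + k).choose k) *
      PowerSeries.coeff (k - j) (PowerSeries.mk δ ^ j)) ≤ 32 ^ k := by
    intro j hj
    rw [mem_range] at hj
    have h1 : planeCount (c + j) / planeCount (c + 2 * k) ≤ 1 :=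
      div_le_one_of_le₀ (planeCount_mono (by omega)) (planeCount_nonneg _)
    have h2 : ((c + j).choose j : ℝ) / (c + k).choose k ≤ 1 :=
      div_le_one_of_le₀ (by exact_mod_cast choose_le_choose_add (by omega)) (by positivity)
    have h3 : PowerSeries.coeff (k - j) (PowerSeries.mk δ ^ j) ≤ 32 ^ k := by
      refine (coeff_mk_pow_le hδ hδ' _ _).trans ?_
      calc (32 : ℝ) ^ (k - j) * 2 ^ j ≤ 32 ^ (k - j) * 32 ^ j := by gcongr; norm_num
        _ = 32 ^ k := by rw [← pow_add]; congr 1; omega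
    have h4 := coeff_mk_pow_nonneg hδ (k - j) j
    calc _ ≤ 1 * (1 * (32 : ℝ) ^ k) := by
          apply mul_le_mul h1 (mul_le_mul h2 h3 h4 zero_le_one) _ zero_le_one
          positivity
      _ = _ := by ring
  refine (Finset.sum_le_sum h).trans ?_
  rw [sum_const, card_range, nsmul_eq_mul]
  have : ((k + 1 : ℕ) : ℝ) ≤ 2 ^ k := by exact_mod_cast Nat.lt_two_pow_self
  calc _ ≤ (2 : ℝ) ^ k * 32 ^ k := by gcongr
    _ = 64 ^ k := by rw [← mul_pow]; norm_num

lemma pairTerm_nonneg (δ : ℕ → ℝ) (k n : ℕ) : 0 ≤ pairTerm δ k n := by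
  unfold pairTerm; positivity

lemma pairTerm_le (hδ : ∀ i, 0 ≤ δ i) (hδ' : ∀ i, δ i ≤ 16 ^ i) (k n : ℕ) :
    pairTerm δ k n ≤ 8192 ^ k / k.factorial := by
  by_cases h : 2 * k ≤ n
  · obtain ⟨c, rfl⟩ := Nat.exists_eq_add_of_le' h
    rcases Nat.eq_zero_or_pos (c + 2 * k) with h0 | h0
    · rw [pairTerm, h0, planeCount_zero]; simp; positivity
    rw [pairTerm_add δ k c h0]
    have h1 : ((c + k).descFactorial k : ℝ) / (c + k + k).descFactorial k ≤ 1 :=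
      div_le_one_of_le₀ (by exact_mod_cast Nat.descFactorial_le _ (by omega)) (by positivity)
    have h2 := relCoeff_le hδ hδ' k c
    have h3 := relCoeff_nonneg hδ k c
    calc _ ≤ 2 ^ k / (k.factorial : ℝ) * 1 * (64 ^ k) ^ 2 := by gcongr
      _ = _ := by
        rw [show (8192 : ℝ) = 2 * 64 ^ 2 by norm_num, mul_pow, ← pow_mul, ← pow_mul, mul_comm k 2]
        ring
  · rw [pairTerm, quadCoeff, if_neg h]; simp; positivity

lemma tendsto_relCoeff (h0 : δ 0 = 1) (k : ℕ) :
    Tendsto (relCoeff δ k) atTop (𝓝 ((1 / 4) ^ k)) := by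
  have hlim : ∀ j ∈ range (k + 1), Tendsto (fun c => planeCount (c + j) / planeCount (c + 2 * k) *
    (((c + j).choose j / (c + k).choose k) *
      PowerSeries.coeff (k - j) (PowerSeries.mk δ ^ j))) atTop
      (𝓝 (if j = k then (1 / 4) ^ k else 0)) := by
    intro j hj
    rw [mem_range] at hj
    have h1 := (tendsto_planeCount_div (2 * k - j)).comp (tendsto_add_atTop_nat j)
    have h1' : Tendsto (fun c => planeCount (c + j) / planeCount (c + 2 * k)) atTop
        (𝓝 ((1 / 4) ^ (2 * k - j))) := by
      refine h1.congr fun c => ?_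
      simp only [Function.comp]
      rw [show c + j + (2 * k - j) = c + 2 * k by omega]
    split_ifs with hjk
    · subst hjk
      have : PowerSeries.coeff (j - j) (PowerSeries.mk δ ^ j) = 1 := by
        rw [Nat.sub_self, PowerSeries.coeff_zero_eq_constantCoeff_apply, map_pow,
          ← PowerSeries.coeff_zero_eq_constantCoeff_apply, PowerSeries.coeff_mk, h0, one_pow]
      rw [this]
      rw [show 2 * j - j = j by omega] at h1'
      refine h1'.congr fun c => ?_
      have h3 : ((c + j).choose j : ℝ) ≠ 0 := by
        exact_mod_cast (Nat.choose_pos (by omega)).ne'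
      rw [div_self h3, mul_one, mul_one]
    · have := h1'.mul ((tendsto_choose_div (show j < k by omega)).mul_const
        (PowerSeries.coeff (k - j) (PowerSeries.mk δ ^ j)))
      simpa using this
  have := tendsto_finsetSum _ hlim
  rw [Finset.sum_ite_eq' (range (k + 1)) k] at this
  unfold relCoeff
  simpa using this

lemma tendsto_pairTerm (h0 : δ 0 = 1) (k : ℕ) :
    Tendsto (pairTerm δ k) atTop (𝓝 ((1 / 8) ^ k / k.factorial)) := by
  rw [← tendsto_add_atTop_iff_nat (2 * k)]
  have h := ((tendsto_descFactorial_div k k).const_mul (2 ^ k / (k.factorial : ℝ))).mul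
    ((tendsto_relCoeff h0 k).pow 2)
  have e : 2 ^ k / (k.factorial : ℝ) * 1 * ((1 / 4) ^ k) ^ 2 = (1 / 8) ^ k / k.factorial := by
    rw [show (1 / 8 : ℝ) = 2 * (1 / 4) ^ 2 by norm_num, mul_pow, ← pow_mul, ← pow_mul, mul_comm k 2]
    ring
  rw [e] at h
  refine h.congr' ?_
  filter_upwards [eventually_gt_atTop 0] with c hc
  rw [pairTerm_add δ k c (by omega)]

lemma pairTerm_eq_zero {k n : ℕ} (h : n < 2 * k) : pairTerm δ k n = 0 := by
  rw [pairTerm, quadCoeff, if_neg (by omega)]; simp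

lemma tendsto_tsum_pairTerm (h0 : δ 0 = 1) (hδ : ∀ i, 0 ≤ δ i) (hδ' : ∀ i, δ i ≤ 16 ^ i) :
    Tendsto (fun n => ∑ k ∈ range (n + 1), pairTerm δ k n) atTop (𝓝 (Real.exp (1 / 8))) := by
  have hs : Summable fun k : ℕ => (8192 : ℝ) ^ k / k.factorial := Real.summable_pow_div_factorial _
  have := tendsto_tsum_of_dominated_convergence hs (tendsto_pairTerm h0)
    (Eventually.of_forall fun n k => by
      rw [Real.norm_of_nonneg (pairTerm_nonneg _ _ _)]; exact pairTerm_le hδ hδ' k n)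
  rw [show Real.exp (1 / 8) = ∑' k : ℕ, (1 / 8 : ℝ) ^ k / k.factorial by
    rw [Real.exp_eq_exp_ℝ, NormedSpace.exp_eq_tsum_div]]
  refine this.congr fun n => ?_
  apply tsum_eq_sum
  intro k hk
  rw [mem_range] at hk
  exact pairTerm_eq_zero (by omega)

/-- Poisson limit from convergence of binomial moments. -/
lemma tendsto_inclusion_exclusion (h0 : δ 0 = 1) (hδ : ∀ i, 0 ≤ δ i) (hδ' : ∀ i, δ i ≤ 16 ^ i)
    (k : ℕ) :
    Tendsto (fun n => ∑ s ∈ range (n + 1), (-1) ^ s * ((s + k).choose k : ℝ) * pairTerm δ (s + k) n)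
      atTop (𝓝 (Real.exp (-(1 / 8)) * (1 / 8) ^ k / k.factorial)) := by
  have hs : Summable fun s : ℕ => (16384 : ℝ) ^ (s + k) / (s + k).factorial :=
    (summable_nat_add_iff k).mpr (Real.summable_pow_div_factorial 16384)
  have hlim : ∀ s, Tendsto (fun n => (-1) ^ s * ((s + k).choose k : ℝ) * pairTerm δ (s + k) n) atTop
      (𝓝 ((-1) ^ s * ((s + k).choose k : ℝ) * ((1 / 8) ^ (s + k) / (s + k).factorial))) :=
    fun s => (tendsto_pairTerm h0 (s + k)).const_mul _
  have := tendsto_tsum_of_dominated_convergence hs hlim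
    (Eventually.of_forall fun n s => by
      rw [norm_mul, norm_mul, Real.norm_of_nonneg (pairTerm_nonneg _ _ _), norm_pow, norm_neg,
        norm_one, one_pow, one_mul, Real.norm_of_nonneg (by positivity)]
      have h1 : ((s + k).choose k : ℝ) ≤ 2 ^ (s + k) := by
        exact_mod_cast Nat.choose_le_two_pow _ _
      calc _ ≤ (2 : ℝ) ^ (s + k) * (8192 ^ (s + k) / (s + k).factorial) :=
            mul_le_mul h1 (pairTerm_le hδ hδ' _ _) (pairTerm_nonneg _ _ _) (by positivity)
        _ = _ := by rw [← mul_div_assoc, ← mul_pow]; norm_num)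
  have e : ∑' s : ℕ, (-1) ^ s * ((s + k).choose k : ℝ) * ((1 / 8) ^ (s + k) / (s + k).factorial) =
      Real.exp (-(1 / 8)) * (1 / 8) ^ k / k.factorial := by
    rw [Real.exp_eq_exp_ℝ, NormedSpace.exp_eq_tsum_div, mul_div_assoc, ← tsum_mul_right]
    refine tsum_congr fun s => ?_
    have f : ((s + k).choose k : ℝ) * k.factorial * s.factorial = (s + k).factorial := by
      have := Nat.add_choose_mul_factorial_mul_factorial s k
      rw [← this]; push_cast; ring
    have g1 : (0 : ℝ) < s.factorial := by exact_mod_cast Nat.factorial_pos _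
    have g2 : (0 : ℝ) < k.factorial := by exact_mod_cast Nat.factorial_pos _
    have g3 : (0 : ℝ) < (s + k).choose k := by exact_mod_cast Nat.choose_pos (by omega)
    rw [← f, neg_pow (1 / 8 : ℝ) s, pow_add]
    field_simp
  rw [e] at this
  refine this.congr fun n => ?_
  apply tsum_eq_sum
  intro s hs
  rw [mem_range] at hs
  rw [pairTerm_eq_zero (by omega), mul_zero]

end Asymptotics

namespace PTree

open Finset

lemma size_pos (T : PTree) : 0 < T.size := by
  induction T with
  | leaf => exact Nat.one_pos
  | node l r hl hr => rw [size]; omega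

lemma mem_planeTrees {n : ℕ} {T : PTree} : T ∈ planeTrees n ↔ T.size = n := by
  induction n using Nat.strong_induction_on generalizing T with
  | _ n ih =>
    match n, ih with
    | 0, _ => have := size_pos T; simp [planeTrees]; omega
    | 1, _ =>
      rw [planeTrees, mem_singleton]
      cases T with
      | leaf => simp [size]
      | node l r => have := size_pos l; have := size_pos r; simp [size]; omega
    | n + 2, ih =>
      rw [planeTrees]
      simp only [mem_biUnion, mem_attach, true_and, mem_image, mem_product, Prod.exists,
        Subtype.exists, mem_range]
      constructor
      · rintro ⟨k, hk, l, r, ⟨hl, hr⟩, rfl⟩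
        rw [ih _ (by omega)] at hl hr
        rw [size]; omega
      · intro h
        cases T with
        | leaf => simp [size] at h
        | node l r =>
          have h1 := size_pos l; have h2 := size_pos r
          rw [size] at h
          refine ⟨l.size - 1, by omega, l, r, ⟨?_, ?_⟩, rfl⟩
          · rw [ih _ (by omega)]; omega
          · rw [ih _ (by omega)]; omega

lemma planeTrees_eq (n : ℕ) : planeTrees n = (if n = 1 then {leaf} else ∅) ∪
    (antidiagonal n).biUnion fun p => (planeTrees p.1 ×ˢ planeTrees p.2).image
      fun q => node q.1 q.2 := by
  ext T
  simp only [mem_union, mem_biUnion, mem_image, mem_product, HasAntidiagonal.mem_antidiagonal,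
    mem_planeTrees, Prod.exists]
  cases T with
  | leaf => by_cases h : n = 1 <;> simp [size, h, eq_comm]
  | node l r => by_cases h : n = 1 <;> simp [size, h]

lemma sum_planeTrees {M : Type*} [AddCommMonoid M] (n : ℕ) (F : PTree → M) :
    ∑ T ∈ planeTrees n, F T = (if n = 1 then F leaf else 0) +
      ∑ p ∈ antidiagonal n, ∑ l ∈ planeTrees p.1, ∑ r ∈ planeTrees p.2, F (node l r) := by
  rw [planeTrees_eq, sum_union, sum_biUnion]
  · congr 1
    · split_ifs <;> simp
    · refine sum_congr rfl fun p _ => ?_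
      rw [sum_image, sum_product]
      rintro ⟨a, b⟩ _ ⟨c, d⟩ _ h
      simpa using h
  · rintro ⟨a, b⟩ _ ⟨c, d⟩ _ hne
    simp only [Function.onFun]
    rw [Finset.disjoint_left]
    simp only [mem_image, mem_product, mem_planeTrees, Prod.exists, not_exists, not_and]
    rintro _ ⟨l, r, ⟨h1, h2⟩, rfl⟩ l' r' ⟨h3, h4⟩ h
    simp only [node.injEq] at h
    exact hne (by rw [← h1, ← h2, ← h3, ← h4, h.1, h.2])
  · rw [Finset.disjoint_left]
    intro T hT
    split_ifs at hT
    · rw [mem_singleton] at hT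
      simp [hT]
    · simp at hT

lemma card_planeTrees (n : ℕ) : ((planeTrees n).card : ℝ) = planeCount n := by
  induction n using Nat.strong_induction_on with
  | _ n ih =>
    have h : ∑ T ∈ planeTrees n, (1 : ℝ) = (if n = 1 then 1 else 0) +
      ∑ p ∈ antidiagonal n, ∑ l ∈ planeTrees p.1, ∑ r ∈ planeTrees p.2, 1 := sum_planeTrees n _
    simp only [sum_const, nsmul_eq_mul, mul_one] at h
    rw [h, planeCount_eq]
    congr 1
    refine sum_congr rfl fun p hp => ?_
    rw [HasAntidiagonal.mem_antidiagonal] at hp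
    rcases Nat.eq_zero_or_pos p.1 with h1 | h1
    · rw [h1, planeCount_zero]; simp [planeTrees]
    rcases Nat.eq_zero_or_pos p.2 with h2 | h2
    · rw [h2, planeCount_zero]; simp [planeTrees]
    rw [ih _ (by omega), ih _ (by omega)]

/-- The type of leaves of a plane binary tree. -/
def Leaf : PTree → Type
  | leaf => Unit
  | node l r => Leaf l ⊕ Leaf r

noncomputable instance fintypeLeaf : (T : PTree) → Fintype (Leaf T)
  | leaf => inferInstanceAs (Fintype Unit)
  | node l r =>
    letI := fintypeLeaf l
    letI := fintypeLeaf r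
    inferInstanceAs (Fintype (Leaf l ⊕ Leaf r))

lemma card_leaf (T : PTree) : Fintype.card (Leaf T) = T.size := by
  induction T with
  | leaf => rfl
  | node l r hl hr =>
    rw [size, ← hl, ← hr]
    exact Fintype.card_sum (α := Leaf l) (β := Leaf r)

/-- The left-to-right position of a leaf. -/
def pos : (T : PTree) → Leaf T → ℕ
  | leaf, _ => 0
  | node l r, x => Sum.elim (pos l) (fun y => pos r y + l.size) x

@[simp] lemma pos_inl (l r : PTree) (x : Leaf l) : pos (node l r) (Sum.inl x) = pos l x := rfl

@[simp] lemma pos_inr (l r : PTree) (x : Leaf r) :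
    pos (node l r) (Sum.inr x) = pos r x + l.size := rfl

lemma pos_lt (T : PTree) (x : Leaf T) : pos T x < T.size := by
  induction T with
  | leaf => exact Nat.one_pos
  | node l r hl hr =>
    rcases x with x | x
    · have := hl x; rw [pos_inl, size]; omega
    · have := hr x; rw [pos_inr, size]; omega

lemma pos_injective (T : PTree) : Function.Injective (pos T) := by
  induction T with
  | leaf => intro x y _; rfl
  | node l r hl hr =>
    rintro (x | x) (y | y) h
    · rw [hl h]
    · rw [pos_inl, pos_inr] at h; have := pos_lt l x; omega
    · rw [pos_inl, pos_inr] at h; have := pos_lt l y; omega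
    · rw [pos_inr, pos_inr] at h; rw [hr (Nat.add_right_cancel h)]

/-- Leaves are numbered by their positions. -/
noncomputable def posEquiv (T : PTree) : Leaf T ≃ Fin T.size :=
  Equiv.ofBijective (fun x => ⟨pos T x, pos_lt T x⟩) <| by
    rw [Fintype.bijective_iff_injective_and_card, card_leaf, Fintype.card_fin]
    exact ⟨fun x y h => pos_injective T (by simpa using h), rfl⟩

lemma coe_posEquiv (T : PTree) (x : Leaf T) : (posEquiv T x : ℕ) = pos T x := rfl

lemma forall_lt_size {T : PTree} {p : ℕ → Prop} :
    (∀ i < T.size, p i) ↔ ∀ x, p (pos T x) := by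
  refine ⟨fun h x => h _ (pos_lt T x), fun h i hi => ?_⟩
  have := h ((posEquiv T).symm ⟨i, hi⟩)
  rwa [← coe_posEquiv, Equiv.apply_symm_apply] at this

/-- The list of isomorphisms between two trees, as bijections between their leaves. -/
def isoList : (T T' : PTree) → List (Leaf T ≃ Leaf T')
  | leaf, leaf => [Equiv.refl Unit]
  | node l r, node l' r' =>
      ((isoList l l').flatMap fun g => (isoList r r').map fun h =>
        (Equiv.sumCongr g h : Leaf l ⊕ Leaf r ≃ Leaf l' ⊕ Leaf r'))
      ++
      ((isoList l r').flatMap fun g => (isoList r l').map fun h =>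
        ((Equiv.sumCongr g h).trans (Equiv.sumComm _ _) : Leaf l ⊕ Leaf r ≃ Leaf l' ⊕ Leaf r'))
  | leaf, node _ _ => []
  | node _ _, leaf => []

lemma forall₂_isoFuns (T T' : PTree) : List.Forall₂
    (fun (f : ℕ → ℕ) (e : Leaf T ≃ Leaf T') => ∀ x, f (pos T x) = pos T' (e x))
    (isoFuns T T') (isoList T T') := by
  induction T generalizing T' with
  | leaf =>
    cases T' with
    | leaf => exact List.Forall₂.cons (fun _ => rfl) List.Forall₂.nil
    | node l' r' => exact List.Forall₂.nil
  | node l r hl hr =>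
    cases T' with
    | leaf => exact List.Forall₂.nil
    | node l' r' =>
      rw [isoFuns, isoList]
      refine List.rel_append (List.rel_flatMap (hl l') fun f e hfe => List.rel_map
        (fun f' e' hfe' => ?_) (hr r')) (List.rel_flatMap (hl r') fun f e hfe => List.rel_map
        (fun f' e' hfe' => ?_) (hr l'))
      · rintro (x | x)
        · have := pos_lt l x
          simp only [pos_inl, this, if_true, hfe]
          rfl
        · simp only [pos_inr, not_lt.mpr (Nat.le_add_left _ _), if_false, Nat.add_sub_cancel, hfe']
          rfl
      · rintro (x | x)
        · have := pos_lt l x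
          simp only [pos_inl, this, if_true, hfe]
          rfl
        · simp only [pos_inr, not_lt.mpr (Nat.le_add_left _ _), if_false, Nat.add_sub_cancel, hfe']
          rfl

/-- Straight isomorphisms between two trees with two branches. -/
def straight {l r l' r' : PTree} (g : Leaf l ≃ Leaf l') (h : Leaf r ≃ Leaf r') :
    Leaf (node l r) ≃ Leaf (node l' r') :=
  (Equiv.sumCongr g h : Leaf l ⊕ Leaf r ≃ Leaf l' ⊕ Leaf r')

/-- Isomorphisms between two trees which exchange the branches. -/
def crossed {l r l' r' : PTree} (g : Leaf l ≃ Leaf r') (h : Leaf r ≃ Leaf l') :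
    Leaf (node l r) ≃ Leaf (node l' r') :=
  ((Equiv.sumCongr g h).trans (Equiv.sumComm _ _) : Leaf l ⊕ Leaf r ≃ Leaf l' ⊕ Leaf r')

section apply
variable {l r l' r' : PTree}

@[simp] lemma straight_inl (g : Leaf l ≃ Leaf l') (h : Leaf r ≃ Leaf r') (x : Leaf l) :
    straight g h (Sum.inl x) = Sum.inl (g x) := rfl

@[simp] lemma straight_inr (g : Leaf l ≃ Leaf l') (h : Leaf r ≃ Leaf r') (x : Leaf r) :
    straight g h (Sum.inr x) = Sum.inr (h x) := rfl

@[simp] lemma crossed_inl (g : Leaf l ≃ Leaf r') (h : Leaf r ≃ Leaf l') (x : Leaf l) :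
    crossed g h (Sum.inl x) = Sum.inr (g x) := rfl

@[simp] lemma crossed_inr (g : Leaf l ≃ Leaf r') (h : Leaf r ≃ Leaf l') (x : Leaf r) :
    crossed g h (Sum.inr x) = Sum.inl (h x) := rfl

lemma straight_injective : Function.Injective
    fun p : (Leaf l ≃ Leaf l') × (Leaf r ≃ Leaf r') => straight p.1 p.2 := by
  rintro ⟨g, h⟩ ⟨g', h'⟩ e
  ext x
  · exact Sum.inl_injective (Equiv.congr_fun e (Sum.inl x))
  · exact Sum.inr_injective (Equiv.congr_fun e (Sum.inr x))

lemma crossed_injective : Function.Injective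
    fun p : (Leaf l ≃ Leaf r') × (Leaf r ≃ Leaf l') => crossed p.1 p.2 := by
  rintro ⟨g, h⟩ ⟨g', h'⟩ e
  ext x
  · exact Sum.inr_injective (Equiv.congr_fun e (Sum.inl x))
  · exact Sum.inl_injective (Equiv.congr_fun e (Sum.inr x))

lemma nonempty_leaf (T : PTree) : Nonempty (Leaf T) := by
  rw [← Fintype.card_pos_iff, card_leaf]; exact size_pos T

lemma straight_ne_crossed (g : Leaf l ≃ Leaf l') (h : Leaf r ≃ Leaf r') (g' : Leaf l ≃ Leaf r')
    (h' : Leaf r ≃ Leaf l') : straight g h ≠ crossed g' h' := by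
  intro e
  obtain ⟨x⟩ := nonempty_leaf l
  exact Sum.inl_ne_inr (Equiv.congr_fun e (Sum.inl x))

end apply

lemma isoList_node (l r l' r' : PTree) : isoList (node l r) (node l' r') =
    ((isoList l l').flatMap fun g => (isoList r r').map fun h => straight g h) ++
    ((isoList l r').flatMap fun g => (isoList r l').map fun h => crossed g h) := rfl

/-- The set of isomorphisms between two trees, as bijections between their leaves. -/
noncomputable def isos (T T' : PTree) : Finset (Leaf T ≃ Leaf T') := (isoList T T').toFinset

lemma isos_node (l r l' r' : PTree) : isos (node l r) (node l' r') =
    ((isos l l' ×ˢ isos r r').image fun p => straight p.1 p.2) ∪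
    ((isos l r' ×ˢ isos r l').image fun p => crossed p.1 p.2) := by
  ext e
  simp only [isos, isoList_node, List.mem_toFinset, List.mem_append, List.mem_flatMap,
    List.mem_map, mem_union, mem_image, mem_product, Prod.exists]
  simp only [and_assoc, exists_and_left]

lemma isos_leaf_leaf : isos leaf leaf = {(Equiv.refl _ : Leaf leaf ≃ Leaf leaf)} := by
  rw [isos, isoList]; rfl

lemma mem_isos_leaf_leaf (e : Leaf leaf ≃ Leaf leaf) : e ∈ isos leaf leaf := by
  rw [isos_leaf_leaf, mem_singleton]; ext x; rfl

lemma isos_leaf_node (l r : PTree) : isos leaf (node l r) = ∅ := by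
  rw [isos, isoList]; rfl

lemma isos_node_leaf (l r : PTree) : isos (node l r) leaf = ∅ := by
  rw [isos, isoList]; rfl

lemma mem_isos_node {l r l' r' : PTree} {e : Leaf (node l r) ≃ Leaf (node l' r')} :
    e ∈ isos (node l r) (node l' r') ↔ (∃ g ∈ isos l l', ∃ h ∈ isos r r', straight g h = e) ∨
      ∃ g ∈ isos l r', ∃ h ∈ isos r l', crossed g h = e := by
  simp only [isos_node, mem_union, mem_image, mem_product, Prod.exists]
  simp only [and_assoc, exists_and_left]

lemma sum_isos_node {M : Type*} [AddCommMonoid M] {l r l' r' : PTree}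
    (F : (Leaf (node l r) ≃ Leaf (node l' r')) → M) :
    ∑ e ∈ isos (node l r) (node l' r'), F e =
      ∑ g ∈ isos l l', ∑ h ∈ isos r r', F (straight g h) +
      ∑ g ∈ isos l r', ∑ h ∈ isos r l', F (crossed g h) := by
  rw [isos_node, sum_union, sum_image, sum_image, sum_product, sum_product]
  · exact crossed_injective.injOn
  · exact straight_injective.injOn
  · rw [Finset.disjoint_left]
    simp only [mem_image, Prod.exists, not_exists, not_and]
    rintro _ ⟨g, h, _, rfl⟩ g' h' _ e
    exact straight_ne_crossed _ _ _ _ e.symm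

lemma length_isoList (T T' : PTree) : (isoList T T').length = (isos T T').card := by
  induction T generalizing T' with
  | leaf =>
    cases T'
    · rw [isos_leaf_leaf]; rfl
    · rw [isos_leaf_node]; rfl
  | node l r hl hr =>
    cases T' with
    | leaf => rw [isos_node_leaf]; rfl
    | node l' r' =>
      have := sum_isos_node (l := l) (r := r) (l' := l') (r' := r') fun _ => 1
      simp only [sum_const, smul_eq_mul, mul_one] at this
      rw [this, isoList_node, List.length_append, List.length_flatMap, List.length_flatMap,
        ← hl, ← hl, ← hr, ← hr]
      simp

lemma nodup_isoList (T T' : PTree) : (isoList T T').Nodup := by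
  rw [← List.dedup_eq_self]
  apply (List.dedup_sublist _).eq_of_length
  rw [length_isoList, isos, List.card_toFinset]

lemma refl_mem_isos (T : PTree) : Equiv.refl _ ∈ isos T T := by
  induction T with
  | leaf => exact mem_isos_leaf_leaf _
  | node l r hl hr =>
    rw [mem_isos_node]
    refine Or.inl ⟨_, hl, _, hr, ?_⟩
    ext (x | x) <;> rfl

lemma symm_mem_isos {T T' : PTree} {e : Leaf T ≃ Leaf T'} (he : e ∈ isos T T') :
    e.symm ∈ isos T' T := by
  induction T generalizing T' with
  | leaf =>
    cases T' with
    | leaf => exact mem_isos_leaf_leaf _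
    | node l' r' => simp [isos_leaf_node] at he
  | node l r hl hr =>
    cases T' with
    | leaf => simp [isos_node_leaf] at he
    | node l' r' =>
      rw [mem_isos_node] at he ⊢
      rcases he with ⟨g, hg, h, hh, rfl⟩ | ⟨g, hg, h, hh, rfl⟩
      · refine Or.inl ⟨_, hl hg, _, hr hh, ?_⟩
        ext (x | x) <;> rfl
      · refine Or.inr ⟨_, hr hh, _, hl hg, ?_⟩
        ext (x | x) <;> rfl

lemma trans_mem_isos {T T' T'' : PTree} {e : Leaf T ≃ Leaf T'} {f : Leaf T' ≃ Leaf T''}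
    (he : e ∈ isos T T') (hf : f ∈ isos T' T'') : e.trans f ∈ isos T T'' := by
  induction T generalizing T' T'' with
  | leaf =>
    cases T' with
    | leaf =>
      cases T'' with
      | leaf => exact mem_isos_leaf_leaf _
      | node l' r' => simp [isos_leaf_node] at hf
    | node l' r' => simp [isos_leaf_node] at he
  | node l r hl hr =>
    cases T' with
    | leaf => simp [isos_node_leaf] at he
    | node l' r' =>
      cases T'' with
      | leaf => simp [isos_node_leaf] at hf
      | node l'' r'' =>
        rw [mem_isos_node] at he hf ⊢
        rcases he with ⟨g, hg, h, hh, rfl⟩ | ⟨g, hg, h, hh, rfl⟩ <;>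
        rcases hf with ⟨g', hg', h', hh', rfl⟩ | ⟨g', hg', h', hh', rfl⟩
        · refine Or.inl ⟨_, hl hg hg', _, hr hh hh', ?_⟩
          ext (x | x) <;> rfl
        · refine Or.inr ⟨_, hl hg hg', _, hr hh hh', ?_⟩
          ext (x | x) <;> rfl
        · refine Or.inr ⟨_, hl hg hh', _, hr hh hg', ?_⟩
          ext (x | x) <;> rfl
        · refine Or.inl ⟨_, hl hg hh', _, hr hh hg', ?_⟩
          ext (x | x) <;> rfl

lemma size_eq_of_mem_isos {T T' : PTree} (e : Leaf T ≃ Leaf T') : T.size = T'.size := by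
  rw [← card_leaf, ← card_leaf, Fintype.card_congr e]

lemma sum_card_isos (T : PTree) (n : ℕ) :
    ∑ T' ∈ planeTrees n, (isos T T').card = if T.size = n then 2 ^ (n - 1) else 0 := by
  induction T generalizing n with
  | leaf =>
    rw [sum_planeTrees]
    simp only [isos_leaf_leaf, isos_leaf_node, card_singleton, card_empty, sum_const_zero, add_zero,
      eq_comm (a := n)]
    have hs : leaf.size = 1 := rfl
    by_cases h : 1 = n
    · rw [if_pos h, if_pos (hs.trans h), ← h]; rfl
    · rw [if_neg h, if_neg (by rwa [hs])]
  | node l r hl hr =>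
    rw [sum_planeTrees, isos_node_leaf, card_empty, ite_self, zero_add]
    have h1 : ∀ l' r', (isos (node l r) (node l' r')).card =
        (isos l l').card * (isos r r').card + (isos l r').card * (isos r l').card := by
      intro l' r'
      have := sum_isos_node (l := l) (r := r) (l' := l') (r' := r') fun _ => 1
      simpa only [sum_const, smul_eq_mul, mul_one] using this
    have h2 : ∀ p : ℕ × ℕ, ∑ l' ∈ planeTrees p.1, ∑ r' ∈ planeTrees p.2,
        (isos (node l r) (node l' r')).card =
        (if p = (l.size, r.size) then 2 ^ (l.size - 1) * 2 ^ (r.size - 1) else 0) +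
        (if p = (r.size, l.size) then 2 ^ (l.size - 1) * 2 ^ (r.size - 1) else 0) := by
      rintro ⟨i, j⟩
      simp only [h1, sum_add_distrib]
      rw [← sum_mul_sum, hl, hr, sum_comm, ← sum_mul_sum, hl, hr]
      simp only [Prod.mk.injEq, eq_comm (a := i), eq_comm (a := j)]
      congr 1
      · by_cases h : l.size = i <;> by_cases h' : r.size = j <;> simp [h, h']
      · by_cases h : l.size = j <;> by_cases h' : r.size = i <;> simp [h, h']
    simp only [h2, sum_add_distrib, sum_ite_eq', HasAntidiagonal.mem_antidiagonal]
    have := size_pos l; have := size_pos r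
    rw [add_comm r.size, size]
    split_ifs with h
    · rw [← h, ← pow_add, ← two_mul, ← pow_succ']
      congr 1; omega
    · rfl

end PTree

section PermCongr

open Finset Equiv Equiv.Perm

lemma prod_mul_prod_factorial_count_le (m : Multiset ℕ) (S : Finset ℕ) {k : ℕ}
    (hm : ∀ a ∈ m, 2 ∣ a ∧ 0 < a) (hk : m.sum = 2 * k) :
    m.prod * ∏ n ∈ S, (m.count n).factorial ≤ 2 ^ k * k.factorial := by
  induction m using Multiset.induction_on generalizing k with
  | empty => simp at hk; subst hk; simp
  | cons a m ih =>
    obtain ⟨⟨μ, rfl⟩, ha⟩ := hm a (Multiset.mem_cons_self _ _)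
    rw [Multiset.sum_cons] at hk
    obtain ⟨j, rfl⟩ : ∃ j, k = j + μ := ⟨k - μ, by omega⟩
    have hj : m.sum = 2 * j := by omega
    have ih := ih (fun b hb => hm b (Multiset.mem_cons_of_mem hb)) hj
    have hc : m.count (2 * μ) ≤ j := by
      have h1 : m.count (2 * μ) * (2 * μ) ≤ m.sum := by
        have := Multiset.le_count_iff_replicate_le.mp (le_refl (m.count (2 * μ)))
        obtain ⟨u, hu⟩ := Multiset.le_iff_exists_add.mp this
        conv_rhs => rw [hu]
        rw [Multiset.sum_add, Multiset.sum_replicate, smul_eq_mul]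
        omega
      have : 1 ≤ μ := by omega
      nlinarith
    have h2 : ∏ n ∈ S, ((2 * μ ::ₘ m).count n).factorial ≤
        (m.count (2 * μ) + 1) * ∏ n ∈ S, (m.count n).factorial := by
      by_cases hS : 2 * μ ∈ S
      · rw [← Finset.mul_prod_erase _ _ hS, ← Finset.mul_prod_erase _ _ hS,
          Multiset.count_cons_self, Nat.factorial_succ, mul_assoc]
        refine le_of_eq ?_
        congr 2
        refine Finset.prod_congr rfl fun n hn => ?_
        rw [Multiset.count_cons_of_ne (Finset.ne_of_mem_erase hn)]
      · refine le_trans (le_of_eq ?_) (Nat.le_mul_of_pos_left _ (Nat.succ_pos _))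
        refine Finset.prod_congr rfl fun n hn => ?_
        rw [Multiset.count_cons_of_ne (by rintro rfl; exact hS hn)]
    have h3 : (j + 1) * (j.factorial * μ.factorial) ≤ (j + μ).factorial := by
      rw [← Nat.add_choose_mul_factorial_mul_factorial j μ, mul_assoc]
      refine Nat.mul_le_mul_right _ ?_
      calc j + 1 = (j + 1).choose j := by rw [Nat.choose_succ_self_right]
        _ ≤ (j + μ).choose j := Nat.choose_le_choose _ (by omega)
        _ = (j + μ).choose μ := Nat.choose_symm_add
    have h4 : 2 * μ ≤ 2 ^ μ * μ.factorial :=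
      Nat.mul_le_mul (Nat.le_self_pow (by omega) 2) (Nat.self_le_factorial μ)
    rw [Multiset.prod_cons]
    calc 2 * μ * m.prod * ∏ n ∈ S, ((2 * μ ::ₘ m).count n).factorial
        ≤ 2 * μ * m.prod * ((m.count (2 * μ) + 1) * ∏ n ∈ S, (m.count n).factorial) := by gcongr
      _ = 2 * μ * (m.count (2 * μ) + 1) * (m.prod * ∏ n ∈ S, (m.count n).factorial) := by ring
      _ ≤ (2 ^ μ * μ.factorial) * (j + 1) * (2 ^ j * j.factorial) := by gcongr
      _ = 2 ^ (j + μ) * ((j + 1) * (j.factorial * μ.factorial)) := by ring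
      _ ≤ _ := by gcongr

/-- A set of pairwise disjoint transpositions. -/
def DisjointSwaps {α : Type*} (A : Finset (Perm α)) : Prop :=
  (∀ σ ∈ A, σ.IsSwap) ∧ (A : Set (Perm α)).Pairwise Disjoint

lemma DisjointSwaps.mono {α : Type*} {A B : Finset (Perm α)} (hB : DisjointSwaps B) (h : A ⊆ B) :
    DisjointSwaps A :=
  ⟨fun σ hσ => hB.1 σ (h hσ), hB.2.mono (by exact_mod_cast h)⟩

lemma permCongr_swap {α β : Type*} (v : α ≃ β) (x y : α) :
    v.permCongr (swap x y) = swap (v x) (v y) := by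
  rw [permCongr_def]
  exact Equiv.symm_trans_swap_trans x y v

lemma DisjointSwaps.image {α β : Type*} [DecidableEq (Perm β)] {A : Finset (Perm α)}
    (hA : DisjointSwaps A) (v : α ≃ β) :
    DisjointSwaps (A.image v.permCongr) := by
  constructor
  · simp only [mem_image]
    rintro _ ⟨σ, hσ, rfl⟩
    obtain ⟨x, y, hxy, rfl⟩ := hA.1 σ hσ
    exact ⟨v x, v y, v.injective.ne hxy, permCongr_swap _ _ _⟩
  · rw [coe_image]
    rintro _ ⟨σ, hσ, rfl⟩ _ ⟨τ, hτ, rfl⟩ hne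
    have := hA.2 hσ hτ (by rintro rfl; exact hne rfl)
    intro x
    rcases this (v.symm x) with h | h
    · left; simp [h]
    · right; simp [h]

variable {α β : Type*} [Fintype α] [Fintype β]

lemma card_filter_permCongr_eq {v₀ : α ≃ β} {a : Perm α} {b : Perm β} (h : v₀.permCongr a = b) :
    (univ.filter fun v : α ≃ β => v.permCongr a = b).card =
      (Fintype.card α - a.cycleType.sum).factorial * a.cycleType.prod *
        ∏ n ∈ a.cycleType.toFinset, (a.cycleType.count n).factorial := by
  rw [← nat_card_centralizer, ← Fintype.card_subtype, ← Nat.card_eq_fintype_card]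
  refine Nat.card_congr ⟨fun v => ⟨v.1.trans v₀.symm, ?_⟩, fun w => ⟨w.1.trans v₀, ?_⟩,
    fun v => ?_, fun w => ?_⟩
  · rw [Subgroup.mem_centralizer_singleton_iff]
    have h2 := h.trans v.2.symm
    ext x
    have h3 := Equiv.congr_fun h2 (v.1 x)
    simp only [permCongr_apply, symm_apply_apply] at h3
    simp [Perm.mul_apply, ← h3]
  · have h2 := Subgroup.mem_centralizer_singleton_iff.mp w.2
    rw [← h]
    ext x
    have h3 := Equiv.congr_fun h2 (w.1.symm (v₀.symm x))
    simpa [Perm.mul_apply] using h3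
  · ext x; simp
  · ext x; simp

lemma card_support_permCongr (v : α ≃ β) (a : Perm α) :
    (v.permCongr a).support.card = a.support.card := by
  symm
  refine Finset.card_bij (fun x _ => v x) ?_ (fun x _ y _ h => v.injective h) ?_
  · intro x hx
    simpa using hx
  · intro y hy
    exact ⟨v.symm y, by simpa [← Equiv.eq_symm_apply] using hy, by simp⟩

/-- The number of bijections conjugating two permutations of 2-power order. -/
lemma card_filter_permCongr_le {a : Perm α} {b : Perm β} {k m : ℕ} (ha : a ^ 2 ^ m = 1)
    (hk : a.support.card = 2 * k) :
    (univ.filter fun v : α ≃ β => v.permCongr a = b).card ≤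
      if b.support.card = 2 * k then (Fintype.card α - 2 * k).factorial * 2 ^ k * k.factorial
      else 0 := by
  by_cases h : ∃ v : α ≃ β, v.permCongr a = b
  · obtain ⟨v, h⟩ := h
    rw [card_filter_permCongr_eq h, if_pos (by rw [← h, card_support_permCongr, hk]),
      sum_cycleType, hk, mul_assoc, mul_assoc]
    refine Nat.mul_le_mul_left _ ?_
    apply prod_mul_prod_factorial_count_le
    · intro c hc
      refine ⟨?_, by have := two_le_of_mem_cycleType hc; omega⟩
      have h1 := (dvd_of_mem_cycleType hc).trans (orderOf_dvd_of_pow_eq_one ha)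
      obtain ⟨i, _, rfl⟩ := (Nat.dvd_prime_pow Nat.prime_two).mp h1
      have := two_le_of_mem_cycleType hc
      rcases i with _ | i
      · simp at this
      · exact ⟨2 ^ i, by ring⟩
    · rw [sum_cycleType, hk]
  · rw [Finset.card_eq_zero.mpr]
    · exact Nat.zero_le _
    · rw [Finset.filter_eq_empty_iff]
      exact fun v _ hv => h ⟨v, hv⟩

lemma even_card_support {a : Perm α} {m : ℕ} (ha : a ^ 2 ^ m = 1) : 2 ∣ a.support.card := by
  rw [← sum_cycleType]
  refine Multiset.dvd_sum fun c hc => ?_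
  have h1 := (dvd_of_mem_cycleType hc).trans (orderOf_dvd_of_pow_eq_one ha)
  obtain ⟨i, _, rfl⟩ := (Nat.dvd_prime_pow Nat.prime_two).mp h1
  have := two_le_of_mem_cycleType hc
  rcases i with _ | i
  · simp at this
  · exact ⟨2 ^ i, by ring⟩

lemma DisjointSwaps.exists_perm {A : Finset (Perm α)} (hA : DisjointSwaps A) :
    ∃ a : Perm α, a.cycleFactorsFinset = A :=
  ⟨_, cycleFactorsFinset_eq_finset.mpr ⟨fun f hf => (hA.1 f hf).isCycle, hA.2, rfl⟩⟩

lemma cycleType_of_disjointSwaps {a : Perm α} (ha : DisjointSwaps a.cycleFactorsFinset) :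
    a.cycleType = Multiset.replicate a.cycleFactorsFinset.card 2 := by
  rw [cycleType_def, Multiset.eq_replicate]
  refine ⟨by simp, fun b hb => ?_⟩
  simp only [Multiset.mem_map, Finset.mem_val, Function.comp] at hb
  obtain ⟨σ, hσ, rfl⟩ := hb
  exact card_support_eq_two.mpr (ha.1 σ hσ)

lemma cycleFactorsFinset_permCongr (v : α ≃ β) {a : Perm α}
    (ha : DisjointSwaps a.cycleFactorsFinset) :
    (v.permCongr a).cycleFactorsFinset = a.cycleFactorsFinset.image v.permCongr := by
  have h : ∀ σ ∈ a.cycleFactorsFinset, v.permCongr σ ∈ (v.permCongr a).cycleFactorsFinset := by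
    intro σ hσ
    rw [mem_cycleFactorsFinset_iff]
    refine ⟨((ha.image v).1 _ (mem_image_of_mem _ hσ)).isCycle, fun x hx => ?_⟩
    rw [permCongr_apply, permCongr_apply, (mem_cycleFactorsFinset_iff.mp hσ).2]
    rw [Perm.mem_support] at hx ⊢
    intro h
    apply hx
    rw [permCongr_apply, h, apply_symm_apply]
  refine Finset.Subset.antisymm (fun f hf => ?_) (fun f hf => ?_)
  · obtain ⟨x, hx⟩ := (mem_cycleFactorsFinset_iff.mp hf).1.nonempty_support
    have hx' : v.symm x ∈ a.support := by
      have h1 := mem_cycleFactorsFinset_support_le hf hx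
      rw [Perm.mem_support, permCongr_apply] at h1
      rw [Perm.mem_support]
      intro h2
      rw [h2, apply_symm_apply] at h1
      exact h1 rfl
    rw [← cycleOf_mem_cycleFactorsFinset_iff] at hx'
    have h2 := h _ hx'
    rw [mem_image]
    refine ⟨_, hx', ?_⟩
    by_contra hne
    rcases cycleFactorsFinset_pairwise_disjoint _ h2 hf hne x with h3 | h3
    · rw [permCongr_apply, cycleOf_apply_self] at h3
      have h1 := mem_cycleFactorsFinset_support_le hf hx
      rw [Perm.mem_support, permCongr_apply] at h1
      exact h1 h3
    · exact Perm.mem_support.mp hx h3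
  · obtain ⟨σ, hσ, rfl⟩ := mem_image.mp hf
    exact h σ hσ

lemma card_filter_image_permCongr {A : Finset (Perm α)} {B : Finset (Perm β)} {s : ℕ}
    (hA : DisjointSwaps A) (hB : DisjointSwaps B) (hAs : A.card = s) (hBs : B.card = s)
    (hαβ : Fintype.card α = Fintype.card β) :
    (univ.filter fun v : α ≃ β => A.image v.permCongr = B).card =
      (Fintype.card α - 2 * s).factorial * 2 ^ s * s.factorial := by
  obtain ⟨a, rfl⟩ := hA.exists_perm
  obtain ⟨b, rfl⟩ := hB.exists_perm
  have h1 : ∀ v : α ≃ β, a.cycleFactorsFinset.image v.permCongr = b.cycleFactorsFinset ↔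
      v.permCongr a = b := by
    intro v
    rw [← cycleFactorsFinset_permCongr v hA, cycleFactorsFinset_injective.eq_iff]
  simp only [h1]
  obtain ⟨v₁⟩ := Fintype.card_eq.mp hαβ
  have h2 : IsConj (v₁.permCongr a) b := by
    rw [isConj_iff_cycleType_eq, cycleType_of_disjointSwaps hB, cycleType_of_disjointSwaps,
      cycleFactorsFinset_permCongr v₁ hA, card_image_of_injective _ v₁.permCongr.injective,
      hAs, hBs]
    rw [cycleFactorsFinset_permCongr v₁ hA]
    exact hA.image v₁
  obtain ⟨c, hc⟩ := isConj_iff.mp h2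
  have h3 : (v₁.trans c).permCongr a = b := by
    rw [← hc]; ext x; simp [Perm.mul_apply]
  rw [card_filter_permCongr_eq h3, cycleType_of_disjointSwaps hA, hAs]
  rcases Nat.eq_zero_or_pos s with rfl | hs
  · simp
  · rw [Multiset.toFinset_replicate, if_neg hs.ne']
    simp [mul_comm]

lemma sum_choose_card_filter {A : Finset (Perm α)} {B : Finset (Perm β)} (s : ℕ)
    (hA : DisjointSwaps A) (hB : DisjointSwaps B) (hαβ : Fintype.card α = Fintype.card β) :
    ∑ v : α ≃ β, (A.filter fun σ => v.permCongr σ ∈ B).card.choose s =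
      A.card.choose s * B.card.choose s *
        ((Fintype.card α - 2 * s).factorial * 2 ^ s * s.factorial) := by
  have h1 : ∀ v : α ≃ β, (A.filter fun σ => v.permCongr σ ∈ B).card.choose s =
      ∑ A' ∈ powersetCard s A, ∑ B' ∈ powersetCard s B,
        if A'.image v.permCongr = B' then 1 else 0 := by
    intro v
    rw [← card_powersetCard]
    simp only [Finset.sum_ite_eq, Finset.sum_boole]
    rw [Nat.cast_id]
    congr 1
    ext A'
    simp only [mem_powersetCard, mem_filter, subset_iff, mem_image]
    constructor
    · rintro ⟨h, h'⟩
      refine ⟨⟨fun x hx => (h hx).1, h'⟩, ?_, ?_⟩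
      · rintro _ ⟨x, hx, rfl⟩; exact (h hx).2
      · rw [card_image_of_injective _ v.permCongr.injective, h']
    · rintro ⟨⟨h, h'⟩, h2, _⟩
      exact ⟨fun x hx => ⟨h hx, h2 ⟨x, hx, rfl⟩⟩, h'⟩
  simp only [h1]
  rw [sum_comm]
  have h2 : ∀ A' ∈ powersetCard s A, ∑ v : α ≃ β, ∑ B' ∈ powersetCard s B,
      (if A'.image v.permCongr = B' then 1 else 0) =
        B.card.choose s * ((Fintype.card α - 2 * s).factorial * 2 ^ s * s.factorial) := by
    intro A' hA'
    rw [mem_powersetCard] at hA'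
    rw [sum_comm, ← card_powersetCard, ← smul_eq_mul, ← sum_const]
    refine sum_congr rfl fun B' hB' => ?_
    rw [mem_powersetCard] at hB'
    rw [sum_boole, Nat.cast_id]
    exact card_filter_image_permCongr (hA.mono hA'.1) (hB.mono hB'.1) hA'.2 hB'.2 hαβ
  rw [sum_congr rfl h2, sum_const, card_powersetCard, smul_eq_mul, ← mul_assoc]

/-- Simultaneous products of matched transpositions give `2 ^ M` symmetries of a matching. -/
lemma two_pow_card_le {A G : Finset (Perm α)} {B H : Finset (Perm β)} (v : α ≃ β)
    (hA : DisjointSwaps A) (hAG : A ⊆ G) (hBH : B ⊆ H)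
    (hG1 : 1 ∈ G) (hG : ∀ a ∈ G, ∀ b ∈ G, a * b ∈ G)
    (hH1 : 1 ∈ H) (hH : ∀ a ∈ H, ∀ b ∈ H, a * b ∈ H) :
    2 ^ (A.filter fun σ => v.permCongr σ ∈ B).card ≤
      (G.filter fun a => v.permCongr a ∈ H).card := by
  rw [← card_powerset]
  refine card_le_card_of_injOn (fun A' => if h : ∃ a : Perm α, a.cycleFactorsFinset = A'
    then h.choose else 1) ?_ ?_
  · intro A' hA'
    have hA' : A' ⊆ A.filter fun σ => v.permCongr σ ∈ B :=
      mem_powerset.mp (Finset.mem_coe.mp hA')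
    have hd := hA.mono (hA'.trans (filter_subset _ _))
    have he := hd.exists_perm
    simp only [dif_pos he]
    have hc := he.choose_spec
    generalize he.choose = a at hc
    subst hc
    rw [Finset.mem_coe, mem_filter]
    constructor
    · rw [← cycleFactorsFinset_noncommProd a]
      exact noncommProd_induction _ _ _ (· ∈ G) (fun a b ha hb => hG a ha b hb) hG1
        fun σ hσ => hAG (mem_filter.mp (hA' hσ)).1
    · rw [← cycleFactorsFinset_noncommProd (v.permCongr a)]
      refine noncommProd_induction _ _ _ (· ∈ H) (fun a b ha hb => hH a ha b hb) hH1 fun σ hσ => ?_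
      rw [cycleFactorsFinset_permCongr v hd] at hσ
      obtain ⟨τ, hτ, rfl⟩ := mem_image.mp hσ
      exact hBH (mem_filter.mp (hA' hτ)).2
  · intro A' hA' A'' hA'' h
    have hA' : A' ⊆ A.filter fun σ => v.permCongr σ ∈ B :=
      mem_powerset.mp (Finset.mem_coe.mp hA')
    have hA'' : A'' ⊆ A.filter fun σ => v.permCongr σ ∈ B :=
      mem_powerset.mp (Finset.mem_coe.mp hA'')
    have h1 := (hA.mono (hA'.trans (filter_subset _ _))).exists_perm
    have h2 := (hA.mono (hA''.trans (filter_subset _ _))).exists_perm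
    simp only [dif_pos h1, dif_pos h2] at h
    rw [← h1.choose_spec, ← h2.choose_spec, h]

end PermCongr

namespace PTree

open Finset Equiv

section Matching
variable {T S T' S' : PTree}

/-- The list of values encoding a bijection between the leaves of two trees. -/
noncomputable def matchList (v : Leaf T ≃ Leaf S) : List ℕ :=
  List.ofFn fun i : Fin T.size => pos S (v ((posEquiv T).symm i))

lemma getD_matchList (v : Leaf T ≃ Leaf S) (x : Leaf T) :
    (matchList v).getD (pos T x) 0 = pos S (v x) := by
  have h := pos_lt T x
  rw [List.getD_eq_getElem _ _ (by simpa [matchList] using h)]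
  simp only [matchList, List.getElem_ofFn]
  congr 2
  rw [Equiv.symm_apply_eq]
  rfl

lemma matchList_injective : Function.Injective (matchList : (Leaf T ≃ Leaf S) → List ℕ) := by
  intro v w h
  ext x
  apply pos_injective
  rw [← getD_matchList, h, getD_matchList]

lemma mem_permutations_iff (n : ℕ) (hT : T.size = n) (hS : S.size = n) {L : List ℕ} :
    L ∈ (List.range n).permutations.toFinset ↔ ∃ v : Leaf T ≃ Leaf S, matchList v = L := by
  rw [List.mem_toFinset, List.mem_permutations]
  constructor
  · intro h
    have hl : L.length = n := by rw [h.length_eq, List.length_range]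
    have hn : L.Nodup := h.nodup_iff.mpr List.nodup_range
    have hlt : ∀ i (hi : i < L.length), L[i] < S.size := by
      intro i hi
      have := h.mem_iff.mp (List.getElem_mem hi)
      rw [List.mem_range] at this
      omega
    have hx : ∀ x : Leaf T, pos T x < L.length := by
      intro x; have := pos_lt T x; omega
    have hinj : Function.Injective fun x : Leaf T =>
        (posEquiv S).symm ⟨L[pos T x]'(hx x), hlt _ (hx x)⟩ := by
      intro x y hxy
      have := (posEquiv S).symm.injective hxy
      rw [Fin.mk.injEq, hn.getElem_inj_iff] at this
      exact pos_injective T this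
    refine ⟨Equiv.ofBijective _ ((Fintype.bijective_iff_injective_and_card _).mpr ⟨hinj, ?_⟩), ?_⟩
    · rw [card_leaf, card_leaf, hT, hS]
    · apply List.ext_getElem
      · rw [matchList, List.length_ofFn, hT, hl]
      · intro i h1 h2
        have : ∀ y : Fin S.size, pos S ((posEquiv S).symm y) = y := by
          intro y; rw [← coe_posEquiv, Equiv.apply_symm_apply]
        simp only [matchList, List.getElem_ofFn, Equiv.ofBijective_apply, this]
        congr 1
        rw [← coe_posEquiv, Equiv.apply_symm_apply]
  · rintro ⟨v, rfl⟩
    rw [List.perm_ext_iff_of_nodup _ List.nodup_range]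
    · intro a
      simp only [matchList, List.mem_ofFn, List.mem_range]
      constructor
      · rintro ⟨i, rfl⟩; rw [← hS]; exact pos_lt _ _
      · intro ha
        refine ⟨posEquiv T (v.symm ((posEquiv S).symm ⟨a, by omega⟩)), ?_⟩
        rw [Equiv.symm_apply_apply, Equiv.apply_symm_apply, ← coe_posEquiv, Equiv.apply_symm_apply]
    · rw [matchList, List.nodup_ofFn]
      exact (pos_injective S).comp (v.injective.comp (posEquiv T).symm.injective)

lemma sum_triples {M : Type*} [AddCommMonoid M] (n : ℕ) (F : PTree × PTree × List ℕ → M) :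
    ∑ t ∈ Triples n, F t = ∑ T ∈ planeTrees n, ∑ S ∈ planeTrees n, ∑ v : Leaf T ≃ Leaf S,
      F (T, S, matchList v) := by
  rw [Triples, sum_product]
  refine sum_congr rfl fun T hT => ?_
  rw [sum_product]
  refine sum_congr rfl fun S hS => ?_
  rw [mem_planeTrees] at hT hS
  symm
  refine sum_bij (fun v _ => matchList v) (fun v _ => ?_) (fun v _ w _ h => matchList_injective h)
    (fun L hL => ?_) (fun _ _ => rfl)
  · exact (mem_permutations_iff n hT hS).mpr ⟨v, rfl⟩
  · obtain ⟨v, rfl⟩ := (mem_permutations_iff n hT hS).mp hL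
    exact ⟨v, mem_univ _, rfl⟩

lemma mem_triples {n : ℕ} {t : PTree × PTree × List ℕ} : t ∈ Triples n ↔
    ∃ T ∈ planeTrees n, ∃ S ∈ planeTrees n, ∃ v : Leaf T ≃ Leaf S, t = (T, S, matchList v) := by
  obtain ⟨T, S, L⟩ := t
  rw [Triples, mem_product, mem_product]
  constructor
  · rintro ⟨hT, hS, hL⟩
    obtain ⟨v, hv⟩ := (mem_permutations_iff n (mem_planeTrees.mp hT) (mem_planeTrees.mp hS)).mp hL
    exact ⟨T, hT, S, hS, v, by rw [hv]⟩
  · rintro ⟨T, hT, S, hS, v, h⟩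
    obtain ⟨rfl, rfl, rfl⟩ : _ ∧ _ ∧ _ := by simpa using h
    exact ⟨hT, hS, (mem_permutations_iff n (mem_planeTrees.mp hT) (mem_planeTrees.mp hS)).mpr
      ⟨v, rfl⟩⟩

/-- Pairs of isomorphisms which transform a matching into another one. -/
noncomputable def homs (v : Leaf T ≃ Leaf S) (v' : Leaf T' ≃ Leaf S') :
    Finset ((Leaf T ≃ Leaf T') × (Leaf S ≃ Leaf S')) :=
  (isos T T' ×ˢ isos S S').filter fun p => p.1.trans v' = v.trans p.2

lemma mem_homs {v : Leaf T ≃ Leaf S} {v' : Leaf T' ≃ Leaf S'}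
    {p : (Leaf T ≃ Leaf T') × (Leaf S ≃ Leaf S')} :
    p ∈ homs v v' ↔ p.1 ∈ isos T T' ∧ p.2 ∈ isos S S' ∧ p.1.trans v' = v.trans p.2 := by
  rw [homs, mem_filter, mem_product, and_assoc]

lemma sum_map_eq_of_forall₂ {α β : Type*} {R : α → β → Prop} {l : List α} {l' : List β}
    (h : List.Forall₂ R l l') {F : α → ℕ} {F' : β → ℕ} (hF : ∀ a b, R a b → F a = F' b) :
    (l.map F).sum = (l'.map F').sum := by
  induction h with
  | nil => rfl
  | cons h _ ih => rw [List.map_cons, List.map_cons, List.sum_cons, List.sum_cons, hF _ _ h, ih]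

lemma countP_eq_of_forall₂ {α β : Type*} {R : α → β → Prop} {l : List α} {l' : List β}
    (h : List.Forall₂ R l l') {p : α → Bool} {p' : β → Bool} (hp : ∀ a b, R a b → p a = p' b) :
    l.countP p = l'.countP p' := by
  induction h with
  | nil => rfl
  | cons h _ ih => rw [List.countP_cons, List.countP_cons, hp _ _ h, ih]

lemma any_eq_of_forall₂ {α β : Type*} {R : α → β → Prop} {l : List α} {l' : List β}
    (h : List.Forall₂ R l l') {p : α → Bool} {p' : β → Bool} (hp : ∀ a b, R a b → p a = p' b) :
    l.any p = l'.any p' := by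
  induction h with
  | nil => rfl
  | cons h _ ih => rw [List.any_cons, List.any_cons, hp _ _ h, ih]

lemma all_range_eq (v : Leaf T ≃ Leaf S) (v' : Leaf T' ≃ Leaf S') {n : ℕ} (hn : T.size = n)
    {f g : ℕ → ℕ} {φ : Leaf T ≃ Leaf T'} {ψ : Leaf S ≃ Leaf S'}
    (hf : ∀ x, f (pos T x) = pos T' (φ x)) (hg : ∀ x, g (pos S x) = pos S' (ψ x)) :
    ((List.range n).all fun i => (matchList v').getD (f i) 0 == g ((matchList v).getD i 0)) =
      decide (φ.trans v' = v.trans ψ) := by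
  subst hn
  rw [Bool.eq_iff_iff, List.all_eq_true, decide_eq_true_iff]
  simp only [List.mem_range, beq_iff_eq]
  rw [forall_lt_size, Equiv.ext_iff]
  simp only [hf, getD_matchList, hg, (pos_injective S').eq_iff, Equiv.trans_apply]

lemma tangleAutCount_matchList (v : Leaf T ≃ Leaf S) :
    tangleAutCount T S (matchList v) = (homs v v).card := by
  have h : ∀ (a : ℕ → ℕ) (φ : Leaf T ≃ Leaf T), (∀ x, a (pos T x) = pos T (φ x)) →
      ((isoFuns S S).countP fun b => (List.range T.size).all fun i =>
        (matchList v).getD (a i) 0 == b ((matchList v).getD i 0)) =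
      ((isos S S).filter fun ψ => φ.trans v = v.trans ψ).card := by
    intro a φ hφ
    rw [countP_eq_of_forall₂ (forall₂_isoFuns S S)
      (fun b ψ hψ => all_range_eq v v rfl hφ hψ), List.countP_eq_length_filter,
      ← List.toFinset_card_of_nodup ((nodup_isoList S S).filter _)]
    congr 1
    ext ψ
    simp [isos]
  rw [tangleAutCount, sum_map_eq_of_forall₂ (forall₂_isoFuns T T) h, homs, card_filter, sum_product]
  have := List.sum_toFinset (fun φ : Leaf T ≃ Leaf T =>
    #{ψ ∈ isos S S | φ.trans v = v.trans ψ}) (nodup_isoList T T)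
  rw [← this]
  simp only [card_filter]
  rfl

lemma equivTriple_matchList (v : Leaf T ≃ Leaf S) (v' : Leaf T' ≃ Leaf S') {n : ℕ}
    (hn : T.size = n) :
    equivTriple n (T, S, matchList v) (T', S', matchList v') = true ↔ (homs v v').Nonempty := by
  rw [equivTriple]
  simp only
  rw [any_eq_of_forall₂ (forall₂_isoFuns T T') (fun f φ hf => any_eq_of_forall₂
    (forall₂_isoFuns S S') (fun g ψ hg => all_range_eq v v' hn hf hg))]
  simp only [List.any_eq_true, decide_eq_true_iff, Finset.Nonempty, mem_homs, Prod.exists, isos,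
    List.mem_toFinset]
  constructor
  · rintro ⟨a, ha, b, hb, h⟩; exact ⟨a, b, ha, hb, h⟩
  · rintro ⟨a, b, ha, hb, h⟩; exact ⟨a, ha, b, hb, h⟩

end Matching

section Cherries
variable {T S T' S' : PTree}

/-- The cherry at the root of a tree with the given branches, if there is one. -/
def rootCherry : (l r : PTree) → List (Leaf (node l r) × Leaf (node l r))
  | leaf, leaf => [(Sum.inl (), Sum.inr ())]
  | leaf, node _ _ => []
  | node _ _, _ => []

/-- The pair of leaves of a tree given by a pair of leaves of its left branch. -/
def inlPair {l : PTree} (r : PTree) (p : Leaf l × Leaf l) : Leaf (node l r) × Leaf (node l r) :=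
  (Sum.inl p.1, Sum.inl p.2)

/-- The pair of leaves of a tree given by a pair of leaves of its right branch. -/
def inrPair (l : PTree) {r : PTree} (p : Leaf r × Leaf r) : Leaf (node l r) × Leaf (node l r) :=
  (Sum.inr p.1, Sum.inr p.2)

/-- The cherries of a tree, as pairs of leaves. -/
def cherryPairs : (T : PTree) → List (Leaf T × Leaf T)
  | leaf => []
  | node l r => rootCherry l r ++
      ((cherryPairs l).map (inlPair r) ++ (cherryPairs r).map (inrPair l))

lemma cherryPairs_node (l r : PTree) : cherryPairs (node l r) = rootCherry l r ++
    ((cherryPairs l).map (inlPair r) ++ (cherryPairs r).map (inrPair l)) := rfl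

lemma cherryList_node (l r : PTree) (k : ℕ) : cherryList (node l r) k =
    (rootCherry l r).map (fun p => (pos _ p.1 + k, pos _ p.2 + k)) ++
      (cherryList l k ++ cherryList r (k + l.size)) := by
  cases l <;> cases r
  · change [(k, k + 1)] = [(0 + k, 0 + 1 + k)]
    rw [zero_add, zero_add, add_comm]
  all_goals simp [cherryList, rootCherry]

lemma cherryList_eq (T : PTree) (k : ℕ) :
    cherryList T k = (cherryPairs T).map fun p => (pos T p.1 + k, pos T p.2 + k) := by
  induction T generalizing k with
  | leaf => simp [cherryList, cherryPairs]
  | node l r hl hr =>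
    rw [cherryList_node, cherryPairs_node, List.map_append, List.map_append, hl, hr, List.map_map,
      List.map_map]
    congr 2
    refine List.map_congr_left fun p _ => ?_
    simp only [Function.comp, inrPair, pos_inr, Prod.mk.injEq]
    omega

lemma mem_rootCherry {l r : PTree} {p : Leaf (node l r) × Leaf (node l r)}
    (h : p ∈ rootCherry l r) : l = leaf ∧ r = leaf ∧ ∃ x y, p = (Sum.inl x, Sum.inr y) := by
  cases l <;> cases r <;> simp only [rootCherry, List.not_mem_nil, List.mem_singleton] at h
  exact ⟨rfl, rfl, _, _, h⟩

lemma mem_cherryPairs_node {l r : PTree} {p : Leaf (node l r) × Leaf (node l r)} :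
    p ∈ cherryPairs (node l r) ↔ p ∈ rootCherry l r ∨
      (∃ q ∈ cherryPairs l, inlPair r q = p) ∨
      ∃ q ∈ cherryPairs r, inrPair l q = p := by
  simp only [cherryPairs_node, List.mem_append, List.mem_map]

lemma ne_of_mem_cherryPairs {p : Leaf T × Leaf T} (hp : p ∈ cherryPairs T) : p.1 ≠ p.2 := by
  induction T with
  | leaf => simp [cherryPairs] at hp
  | node l r hl hr =>
    rw [mem_cherryPairs_node] at hp
    rcases hp with hp | ⟨q, hq, rfl⟩ | ⟨q, hq, rfl⟩
    · obtain ⟨_, _, x, y, rfl⟩ := mem_rootCherry hp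
      exact Sum.inl_ne_inr
    · exact Sum.inl_injective.ne (hl hq)
    · exact Sum.inr_injective.ne (hr hq)

lemma pairwise_cherryPairs (T : PTree) : (cherryPairs T).Pairwise fun p q =>
    p.1 ≠ q.1 ∧ p.1 ≠ q.2 ∧ p.2 ≠ q.1 ∧ p.2 ≠ q.2 := by
  induction T with
  | leaf => exact List.Pairwise.nil
  | node l r hl hr =>
    rw [cherryPairs_node, List.pairwise_append, List.pairwise_append, List.pairwise_map,
      List.pairwise_map]
    refine ⟨?_, ⟨hl.imp fun h => ?_, hr.imp fun h => ?_, ?_⟩, ?_⟩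
    · cases l <;> cases r <;> simp [rootCherry]
    · exact ⟨Sum.inl_injective.ne h.1, Sum.inl_injective.ne h.2.1, Sum.inl_injective.ne h.2.2.1,
        Sum.inl_injective.ne h.2.2.2⟩
    · exact ⟨Sum.inr_injective.ne h.1, Sum.inr_injective.ne h.2.1, Sum.inr_injective.ne h.2.2.1,
        Sum.inr_injective.ne h.2.2.2⟩
    · simp only [List.mem_map]
      rintro _ ⟨p, _, rfl⟩ _ ⟨q, _, rfl⟩
      exact ⟨Sum.inl_ne_inr, Sum.inl_ne_inr, Sum.inl_ne_inr, Sum.inl_ne_inr⟩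
    · intro p hp
      obtain ⟨rfl, rfl, _⟩ := mem_rootCherry hp
      simp [cherryPairs]

/-- The transpositions of the leaves of the cherries of a tree. -/
noncomputable def cherrySwaps (T : PTree) : Finset (Perm (Leaf T)) :=
  ((cherryPairs T).map fun p => swap p.1 p.2).toFinset

lemma mem_cherrySwaps {σ : Perm (Leaf T)} :
    σ ∈ cherrySwaps T ↔ ∃ p ∈ cherryPairs T, swap p.1 p.2 = σ := by
  rw [cherrySwaps, List.mem_toFinset, List.mem_map]

lemma nodup_map_swap (T : PTree) : ((cherryPairs T).map fun p => swap p.1 p.2).Nodup := by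
  rw [List.Nodup, List.pairwise_map]
  refine (pairwise_cherryPairs T).imp_of_mem fun {p q} hp _ h e => ?_
  have := Equiv.congr_fun e p.1
  rw [swap_apply_left, swap_apply_of_ne_of_ne h.1 h.2.1] at this
  exact ne_of_mem_cherryPairs hp this.symm

lemma card_cherrySwaps (T : PTree) : (cherrySwaps T).card = (cherryPairs T).length := by
  rw [cherrySwaps, List.toFinset_card_of_nodup (nodup_map_swap T), List.length_map]

lemma disjointSwaps_cherrySwaps (T : PTree) : DisjointSwaps (cherrySwaps T) := by
  constructor
  · intro σ hσ
    obtain ⟨p, hp, rfl⟩ := mem_cherrySwaps.mp hσ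
    exact ⟨_, _, ne_of_mem_cherryPairs hp, rfl⟩
  · have h : ((cherryPairs T).map fun p => swap p.1 p.2).Pairwise Perm.Disjoint := by
      rw [List.pairwise_map]
      refine (pairwise_cherryPairs T).imp_of_mem fun {p q} hp hq h => ?_
      apply Perm.disjoint_swap_swap
      have h1 := ne_of_mem_cherryPairs hp
      have h2 := ne_of_mem_cherryPairs hq
      simp [h, h1, h2]
    rw [cherrySwaps, List.coe_toFinset]
    exact h.set_pairwise

lemma swap_inlPair {l r : PTree} (q : Leaf l × Leaf l) :
    swap (inlPair r q).1 (inlPair r q).2 = straight (swap q.1 q.2) (Equiv.refl (Leaf r)) := by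
  ext (z | z)
  · exact Function.Injective.swap_apply (α := Leaf l) (β := Leaf (node l r))
      Sum.inl_injective _ _ _
  · exact swap_apply_of_ne_of_ne (α := Leaf (node l r)) Sum.inr_ne_inl Sum.inr_ne_inl

lemma swap_inrPair {l r : PTree} (q : Leaf r × Leaf r) :
    swap (inrPair l q).1 (inrPair l q).2 = straight (Equiv.refl (Leaf l)) (swap q.1 q.2) := by
  ext (z | z)
  · exact swap_apply_of_ne_of_ne (α := Leaf (node l r)) Sum.inl_ne_inr Sum.inl_ne_inr
  · exact Function.Injective.swap_apply (α := Leaf r) (β := Leaf (node l r))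
      Sum.inr_injective _ _ _

lemma swap_mem_isos {p : Leaf T × Leaf T} (hp : p ∈ cherryPairs T) :
    swap p.1 p.2 ∈ isos T T := by
  induction T with
  | leaf => simp [cherryPairs] at hp
  | node l r hl hr =>
    rw [mem_cherryPairs_node] at hp
    rw [mem_isos_node]
    rcases hp with hp | ⟨q, hq, rfl⟩ | ⟨q, hq, rfl⟩
    · obtain ⟨rfl, rfl, x, y, rfl⟩ := mem_rootCherry hp
      refine Or.inr ⟨_, refl_mem_isos leaf, _, refl_mem_isos leaf, ?_⟩
      ext (z | z)
      · exact (swap_apply_left _ _).symm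
      · exact (swap_apply_right _ _).symm
    · exact Or.inl ⟨_, hl hq, _, refl_mem_isos r, (swap_inlPair q).symm⟩
    · exact Or.inl ⟨_, refl_mem_isos l, _, hr hq, (swap_inrPair q).symm⟩

lemma cherrySwaps_subset_isos (T : PTree) : cherrySwaps T ⊆ isos T T := by
  intro σ hσ
  obtain ⟨p, hp, rfl⟩ := mem_cherrySwaps.mp hσ
  exact swap_mem_isos hp

lemma exists_mem_cherryPairs {φ : Leaf T ≃ Leaf T'} (hφ : φ ∈ isos T T') {p : Leaf T × Leaf T}
    (hp : p ∈ cherryPairs T) :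
    (φ p.1, φ p.2) ∈ cherryPairs T' ∨ (φ p.2, φ p.1) ∈ cherryPairs T' := by
  induction T generalizing T' with
  | leaf => simp [cherryPairs] at hp
  | node l r hl hr =>
    cases T' with
    | leaf => simp [isos_node_leaf] at hφ
    | node l' r' =>
      simp only [mem_cherryPairs_node]
      rw [mem_cherryPairs_node] at hp
      rw [mem_isos_node] at hφ
      have leaf_of : ∀ {t : PTree} {g : Leaf leaf ≃ Leaf t}, g ∈ isos leaf t → t = leaf := by
        intro t g hg
        cases t with
        | leaf => rfl
        | node => simp [isos_leaf_node] at hg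
      rcases hp with hp | ⟨q, hq, rfl⟩ | ⟨q, hq, rfl⟩ <;>
      rcases hφ with ⟨g, hg, h, hh, rfl⟩ | ⟨g, hg, h, hh, rfl⟩
      · obtain ⟨rfl, rfl, x, y, rfl⟩ := mem_rootCherry hp
        obtain rfl := leaf_of hg
        obtain rfl := leaf_of hh
        exact Or.inl (Or.inl (List.mem_singleton.mpr rfl))
      · obtain ⟨rfl, rfl, x, y, rfl⟩ := mem_rootCherry hp
        obtain rfl := leaf_of hg
        obtain rfl := leaf_of hh
        exact Or.inr (Or.inl (List.mem_singleton.mpr rfl))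
      · exact (hl hg hq).imp (fun H => Or.inr (Or.inl ⟨_, H, rfl⟩))
          fun H => Or.inr (Or.inl ⟨_, H, rfl⟩)
      · exact (hl hg hq).imp (fun H => Or.inr (Or.inr ⟨_, H, rfl⟩))
          fun H => Or.inr (Or.inr ⟨_, H, rfl⟩)
      · exact (hr hh hq).imp (fun H => Or.inr (Or.inr ⟨_, H, rfl⟩))
          fun H => Or.inr (Or.inr ⟨_, H, rfl⟩)
      · exact (hr hh hq).imp (fun H => Or.inr (Or.inl ⟨_, H, rfl⟩))
          fun H => Or.inr (Or.inl ⟨_, H, rfl⟩)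

lemma permCongr_mem_cherrySwaps {φ : Leaf T ≃ Leaf T'} (hφ : φ ∈ isos T T') {σ : Perm (Leaf T)}
    (hσ : σ ∈ cherrySwaps T) : φ.permCongr σ ∈ cherrySwaps T' := by
  obtain ⟨p, hp, rfl⟩ := mem_cherrySwaps.mp hσ
  rw [permCongr_swap, mem_cherrySwaps]
  rcases exists_mem_cherryPairs hφ hp with h | h
  · exact ⟨_, h, rfl⟩
  · exact ⟨_, h, swap_comm _ _⟩

lemma swap_eq_swap_iff {α : Type*} [DecidableEq α] {a b c d : α} (h : a ≠ b) :
    swap a b = swap c d ↔ a = c ∧ b = d ∨ a = d ∧ b = c := by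
  constructor
  · intro e
    have h1 := Equiv.congr_fun e a
    rw [swap_apply_left] at h1
    by_cases hc : a = c
    · subst hc; rw [swap_apply_left] at h1; exact Or.inl ⟨rfl, h1⟩
    by_cases hd : a = d
    · subst hd; rw [swap_apply_right] at h1; exact Or.inr ⟨rfl, h1⟩
    rw [swap_apply_of_ne_of_ne hc hd] at h1
    exact absurd h1.symm h
  · rintro (⟨rfl, rfl⟩ | ⟨rfl, rfl⟩)
    · rfl
    · exact swap_comm _ _

/-- The cherry transpositions which a matching carries to cherry transpositions. -/
noncomputable def matchedSwaps (v : Leaf T ≃ Leaf S) : Finset (Perm (Leaf T)) :=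
  (cherrySwaps T).filter fun σ => v.permCongr σ ∈ cherrySwaps S

lemma matchedCherries_matchList (v : Leaf T ≃ Leaf S) :
    matchedCherries T S (matchList v) = (matchedSwaps v).card := by
  rw [matchedCherries, cherryList_eq, cherryList_eq, List.countP_map]
  have h1 : matchedSwaps v = (((cherryPairs T).map fun p => swap p.1 p.2).filter
      fun σ => decide (v.permCongr σ ∈ cherrySwaps S)).toFinset := by
    ext σ
    simp [matchedSwaps, cherrySwaps]
  rw [h1, List.toFinset_card_of_nodup ((nodup_map_swap T).filter _), ← List.countP_eq_length_filter,
    List.countP_map]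
  refine List.countP_congr fun p hp => ?_
  have hne : v p.1 ≠ v p.2 := v.injective.ne (ne_of_mem_cherryPairs hp)
  simp only [Function.comp, add_zero, getD_matchList, List.any_map,
    List.any_eq_true, Bool.or_eq_true, Bool.and_eq_true, beq_iff_eq, (pos_injective S).eq_iff,
    decide_eq_true_eq, permCongr_swap, mem_cherrySwaps,
    eq_comm (b := swap (v p.1) (v p.2)), swap_eq_swap_iff hne]

lemma card_matchedSwaps_le (v : Leaf T ≃ Leaf S) :
    2 ^ (matchedSwaps v).card ≤ (homs v v).card := by
  refine (two_pow_card_le v (disjointSwaps_cherrySwaps T) (cherrySwaps_subset_isos T)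
    (cherrySwaps_subset_isos S) (refl_mem_isos T) (fun a ha b hb => trans_mem_isos hb ha)
    (refl_mem_isos S) (fun a ha b hb => trans_mem_isos hb ha)).trans ?_
  refine card_le_card_of_injOn (fun a => (a, v.permCongr a)) (fun a ha => ?_) (fun a _ b _ h => ?_)
  · rw [mem_coe, mem_filter] at ha
    rw [mem_coe, mem_homs]
    refine ⟨ha.1, ha.2, ?_⟩
    ext x
    simp
  · exact (Prod.mk.inj h).1

lemma matchedSwaps_le_of_homs {v : Leaf T ≃ Leaf S} {v' : Leaf T' ≃ Leaf S'}
    (h : (homs v v').Nonempty) : (matchedSwaps v).card ≤ (matchedSwaps v').card := by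
  obtain ⟨⟨φ, ψ⟩, h⟩ := h
  obtain ⟨hφ, hψ, e⟩ := mem_homs.mp h
  refine card_le_card_of_injOn φ.permCongr (fun σ hσ => ?_) φ.permCongr.injective.injOn
  rw [mem_coe, matchedSwaps, mem_filter] at hσ ⊢
  refine ⟨permCongr_mem_cherrySwaps hφ hσ.1, ?_⟩
  have : v'.permCongr (φ.permCongr σ) = ψ.permCongr (v.permCongr σ) := by
    ext x
    have e1 : ∀ x, v' (φ x) = ψ (v x) := fun x => Equiv.congr_fun e x
    have e2 : φ.symm (v'.symm x) = v.symm (ψ.symm x) := by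
      rw [Equiv.symm_apply_eq, Equiv.symm_apply_eq, e1]; simp
    simp [permCongr_apply, e1, e2]
  rw [this]
  exact permCongr_mem_cherrySwaps hψ hσ.2

end Cherries

/-- Counting the classes of an equivalence relation by weighting its elements. -/
lemma card_classes_mul {X : Type*} [DecidableEq X] (s : Finset X) (r : X → X → Prop)
    [DecidableRel r] (N : X → X → ℕ) (M : ℕ)
    (hrefl : ∀ t ∈ s, r t t) (hsymm : ∀ t ∈ s, ∀ t' ∈ s, r t t' → r t' t)
    (htrans : ∀ t ∈ s, ∀ t' ∈ s, ∀ t'' ∈ s, r t t' → r t' t'' → r t t'')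
    (hM : ∀ t ∈ s, ∑ t' ∈ s.filter (r t), N t t' = M)
    (hN : ∀ t ∈ s, ∀ t' ∈ s, r t t' → N t t' = N t' t')
    (P : X → Prop) (hP : ∀ t ∈ s, ∀ t' ∈ s, r t t' → P t → P t') :
    ((s.image fun t => s.filter (r t)).filter fun c => ∃ t ∈ c, P t).card * M =
      ∑ t ∈ s.filter P, N t t := by
  have hmaps : ∀ t ∈ s.filter P, s.filter (r t) ∈
      (s.image fun t => s.filter (r t)).filter fun c => ∃ t ∈ c, P t := by
    intro t ht
    rw [mem_filter] at ht
    exact mem_filter.mpr ⟨mem_image_of_mem _ ht.1, t, mem_filter.mpr ⟨ht.1, hrefl t ht.1⟩, ht.2⟩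
  rw [← sum_fiberwise_of_maps_to hmaps, ← smul_eq_mul]
  symm
  refine sum_eq_card_nsmul fun c hc => ?_
  rw [mem_filter, mem_image] at hc
  obtain ⟨⟨t, ht, rfl⟩, t', ht', hPt'⟩ := hc
  rw [mem_filter] at ht'
  rw [← hM t ht]
  refine sum_congr ?_ fun u hu => ?_
  · ext u
    simp only [mem_filter]
    constructor
    · rintro ⟨⟨hu, _⟩, h⟩
      have : u ∈ s.filter (r u) := mem_filter.mpr ⟨hu, hrefl u hu⟩
      rw [h] at this
      exact mem_filter.mp this
    · rintro ⟨hu, h⟩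
      refine ⟨⟨hu, hP t' ht'.1 u hu ?_ hPt'⟩, ?_⟩
      · exact htrans _ ht'.1 _ ht _ hu (hsymm _ ht _ ht'.1 ht'.2) h
      · ext w
        simp only [mem_filter]
        exact ⟨fun hw => ⟨hw.1, htrans _ ht _ hu _ hw.1 h hw.2⟩,
          fun hw => ⟨hw.1, htrans _ hu _ ht _ hw.1 (hsymm _ ht _ hu h) hw.2⟩⟩
  · rw [mem_filter] at hu
    exact (hN _ ht _ hu.1 hu.2).symm

section Homs
variable {T S T' S' T'' S'' : PTree} {v : Leaf T ≃ Leaf S} {v' : Leaf T' ≃ Leaf S'}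
  {v'' : Leaf T'' ≃ Leaf S''}

lemma refl_mem_homs : (Equiv.refl _, Equiv.refl _) ∈ homs v v :=
  mem_homs.mpr ⟨refl_mem_isos _, refl_mem_isos _, rfl⟩

lemma symm_mem_homs {p : (Leaf T ≃ Leaf T') × (Leaf S ≃ Leaf S')} (hp : p ∈ homs v v') :
    (p.1.symm, p.2.symm) ∈ homs v' v := by
  obtain ⟨h1, h2, h⟩ := mem_homs.mp hp
  refine mem_homs.mpr ⟨symm_mem_isos h1, symm_mem_isos h2, ?_⟩
  ext x
  have := Equiv.congr_fun h (p.1.symm x)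
  simp only [Equiv.trans_apply, Equiv.apply_symm_apply] at this ⊢
  rw [this, Equiv.symm_apply_apply]

lemma trans_mem_homs {p : (Leaf T ≃ Leaf T') × (Leaf S ≃ Leaf S')} (hp : p ∈ homs v v')
    {q : (Leaf T' ≃ Leaf T'') × (Leaf S' ≃ Leaf S'')} (hq : q ∈ homs v' v'') :
    (p.1.trans q.1, p.2.trans q.2) ∈ homs v v'' := by
  obtain ⟨h1, h2, h⟩ := mem_homs.mp hp
  obtain ⟨h3, h4, h'⟩ := mem_homs.mp hq
  refine mem_homs.mpr ⟨trans_mem_isos h1 h3, trans_mem_isos h2 h4, ?_⟩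
  simp only
  rw [Equiv.trans_assoc, h', ← Equiv.trans_assoc, h, Equiv.trans_assoc]

lemma card_homs_eq {w : Leaf T'' ≃ Leaf S''} (h : (homs v v').Nonempty) :
    (homs v w).card = (homs v' w).card := by
  obtain ⟨p, hp⟩ := h
  refine card_bij' (fun q _ => (p.1.symm.trans q.1, p.2.symm.trans q.2))
    (fun q _ => (p.1.trans q.1, p.2.trans q.2)) (fun q hq => trans_mem_homs (symm_mem_homs hp) hq)
    (fun q hq => trans_mem_homs hp hq) (fun q _ => ?_) (fun q _ => ?_) <;>
  simp [← Equiv.trans_assoc]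

lemma sum_card_homs (v : Leaf T ≃ Leaf S) (T' S' : PTree) :
    ∑ v' : Leaf T' ≃ Leaf S', (homs v v').card = (isos T T').card * (isos S S').card := by
  simp only [homs, card_filter, sum_product]
  rw [sum_comm, card_eq_sum_ones, sum_mul]
  refine sum_congr rfl fun φ _ => ?_
  rw [sum_comm, one_mul, card_eq_sum_ones]
  refine sum_congr rfl fun ψ _ => ?_
  have : ∀ v' : Leaf T' ≃ Leaf S', φ.trans v' = v.trans ψ ↔ φ.symm.trans (v.trans ψ) = v' := by
    intro v'
    constructor
    · intro h; rw [← h]; simp [← Equiv.trans_assoc]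
    · rintro rfl; simp [← Equiv.trans_assoc]
  simp only [this, sum_ite_eq, mem_univ, if_true]

end Homs

/-- The number of pairs of isomorphisms of trees which transform a triple into another one. -/
noncomputable def homCount (t t' : PTree × PTree × List ℕ) : ℕ :=
  ((isos t.1 t'.1 ×ˢ isos t.2.1 t'.2.1).filter fun p =>
    ∃ (v : Leaf t.1 ≃ Leaf t.2.1) (v' : Leaf t'.1 ≃ Leaf t'.2.1),
      matchList v = t.2.2 ∧ matchList v' = t'.2.2 ∧ p.1.trans v' = v.trans p.2).card

lemma homCount_matchList {T S T' S' : PTree} (v : Leaf T ≃ Leaf S) (v' : Leaf T' ≃ Leaf S') :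
    homCount (T, S, matchList v) (T', S', matchList v') = (homs v v').card := by
  rw [homCount, homs]
  congr 1
  refine filter_congr fun p _ => ?_
  constructor
  · rintro ⟨w, w', h, h', e⟩
    rw [← matchList_injective h, ← matchList_injective h']
    exact e
  · exact fun e => ⟨v, v', rfl, rfl, e⟩

lemma card_filter_tangleClasses (n : ℕ) (P : PTree × PTree × List ℕ → Prop)
    (hP : ∀ {T S T' S' : PTree} (v : Leaf T ≃ Leaf S) (v' : Leaf T' ≃ Leaf S'),
      (homs v v').Nonempty → P (T, S, matchList v) → P (T', S', matchList v')) :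
    ((tangleClasses n).filter fun c => ∃ t ∈ c, P t).card * (2 ^ (n - 1) * 2 ^ (n - 1)) =
      ∑ t ∈ (Triples n).filter P, tangleAutCount t.1 t.2.1 t.2.2 := by
  have key := card_classes_mul (Triples n) (fun t t' => equivTriple n t t' = true) homCount
    (2 ^ (n - 1) * 2 ^ (n - 1)) ?_ ?_ ?_ ?_ ?_ P ?_
  · rw [tangleClasses, key]
    refine sum_congr rfl fun t ht => ?_
    obtain ⟨T, hT, S, hS, v, rfl⟩ := mem_triples.mp (mem_filter.mp ht).1
    rw [homCount_matchList, tangleAutCount_matchList]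
  · intro t ht
    obtain ⟨T, hT, S, hS, v, rfl⟩ := mem_triples.mp ht
    exact (equivTriple_matchList v v (mem_planeTrees.mp hT)).mpr ⟨_, refl_mem_homs⟩
  · intro t ht t' ht' h
    obtain ⟨T, hT, S, hS, v, rfl⟩ := mem_triples.mp ht
    obtain ⟨T', hT', S', hS', v', rfl⟩ := mem_triples.mp ht'
    obtain ⟨p, hp⟩ := (equivTriple_matchList v v' (mem_planeTrees.mp hT)).mp h
    exact (equivTriple_matchList v' v (mem_planeTrees.mp hT')).mpr ⟨_, symm_mem_homs hp⟩
  · intro t ht t' ht' t'' ht'' h h'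
    obtain ⟨T, hT, S, hS, v, rfl⟩ := mem_triples.mp ht
    obtain ⟨T', hT', S', hS', v', rfl⟩ := mem_triples.mp ht'
    obtain ⟨T'', hT'', S'', hS'', v'', rfl⟩ := mem_triples.mp ht''
    obtain ⟨p, hp⟩ := (equivTriple_matchList v v' (mem_planeTrees.mp hT)).mp h
    obtain ⟨q, hq⟩ := (equivTriple_matchList v' v'' (mem_planeTrees.mp hT')).mp h'
    exact (equivTriple_matchList v v'' (mem_planeTrees.mp hT)).mpr ⟨_, trans_mem_homs hp hq⟩
  · intro t ht
    obtain ⟨T, hT, S, hS, v, rfl⟩ := mem_triples.mp ht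
    rw [sum_filter_of_ne]
    · rw [sum_triples]
      simp only [homCount_matchList, sum_card_homs]
      rw [← sum_mul_sum, sum_card_isos, sum_card_isos, if_pos (mem_planeTrees.mp hT),
        if_pos (mem_planeTrees.mp hS)]
    · intro t' ht' h
      obtain ⟨T', hT', S', hS', v', rfl⟩ := mem_triples.mp ht'
      rw [homCount_matchList, Finset.card_ne_zero] at h
      exact (equivTriple_matchList v v' (mem_planeTrees.mp hT)).mpr h
  · intro t ht t' ht' h
    obtain ⟨T, hT, S, hS, v, rfl⟩ := mem_triples.mp ht
    obtain ⟨T', hT', S', hS', v', rfl⟩ := mem_triples.mp ht'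
    rw [homCount_matchList, homCount_matchList]
    exact card_homs_eq ((equivTriple_matchList v v' (mem_planeTrees.mp hT)).mp h)
  · intro t ht t' ht' h hPt
    obtain ⟨T, hT, S, hS, v, rfl⟩ := mem_triples.mp ht
    obtain ⟨T', hT', S', hS', v', rfl⟩ := mem_triples.mp ht'
    exact hP v v' ((equivTriple_matchList v v' (mem_planeTrees.mp hT)).mp h) hPt

lemma tangleProb_eq (n : ℕ) (P : PTree × PTree × List ℕ → Prop)
    (hP : ∀ {T S T' S' : PTree} (v : Leaf T ≃ Leaf S) (v' : Leaf T' ≃ Leaf S'),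
      (homs v v').Nonempty → P (T, S, matchList v) → P (T', S', matchList v')) :
    tangleProb n P = (∑ t ∈ (Triples n).filter P, tangleAutCount t.1 t.2.1 t.2.2 : ℕ) /
      (∑ t ∈ Triples n, tangleAutCount t.1 t.2.1 t.2.2 : ℕ) := by
  have h : numTanglegrams n * (2 ^ (n - 1) * 2 ^ (n - 1)) =
      ∑ t ∈ Triples n, tangleAutCount t.1 t.2.1 t.2.2 := by
    have := card_filter_tangleClasses n (fun _ => True) (fun _ _ _ h => h)
    have hmem : ∀ c ∈ tangleClasses n, ∃ t ∈ c, True := by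
      intro c hc
      rw [tangleClasses, mem_image] at hc
      obtain ⟨t, ht, rfl⟩ := hc
      obtain ⟨T, hT, S, hS, v, rfl⟩ := mem_triples.mp ht
      exact ⟨_, mem_filter.mpr ⟨ht,
        (equivTriple_matchList v v (mem_planeTrees.mp hT)).mpr ⟨_, refl_mem_homs⟩⟩, trivial⟩
    rw [Finset.filter_true] at this
    rw [← this, numTanglegrams]
    congr 2
    exact (filter_true_of_mem hmem).symm.trans (by congr!)
  rw [← h, ← card_filter_tangleClasses n P hP, tangleProb]
  push_cast
  rw [mul_div_mul_right _ _ (by positivity)]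

/-- Number of automorphisms of a node exchanging two given branches, summed over all pairs
of branches with `i + 1` leaves. -/
noncomputable def exchangeCount (i : ℕ) : ℝ :=
  ∑ l ∈ planeTrees (i + 1), ∑ r ∈ planeTrees (i + 1), ((isos l r).card : ℝ) * (isos r l).card

/-- The cherries at the root contribute only for trees with two leaves. -/
noncomputable def rootCherryCount (i : ℕ) : ℝ := if i = 0 then 1 else 0

section Cherries

lemma card_cherrySwaps_leaf : (cherrySwaps leaf).card = 0 := by
  rw [card_cherrySwaps]; rfl

lemma card_cherrySwaps_node (l r : PTree) : (cherrySwaps (node l r)).card =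
    (if l = leaf ∧ r = leaf then 1 else 0) + ((cherrySwaps l).card + (cherrySwaps r).card) := by
  simp only [card_cherrySwaps, cherryPairs_node, List.length_append, List.length_map]
  congr 1
  cases l <;> cases r <;> simp [rootCherry]

open Polynomial in
lemma sum_choose_card_cherrySwaps (n k : ℕ) :
    ∑ T ∈ planeTrees n, ((cherrySwaps T).card.choose k : ℝ) = quadCoeff rootCherryCount n k := by
  rw [← coeff_eq_quadCoeff rootCherryCount
    (fun n => ∑ T ∈ planeTrees n, (1 + X : ℝ[X]) ^ (cherrySwaps T).card)]
  · simp only [finsetSum_coeff, coeff_one_add_X_pow]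
  · simp [planeTrees]
  · intro n
    rw [sum_planeTrees, card_cherrySwaps_leaf, pow_zero, add_assoc]
    congr 1
    have h1 : ∀ l r, (1 + X : ℝ[X]) ^ (cherrySwaps (node l r)).card =
        (if l = leaf ∧ r = leaf then X else 0) +
          (1 + X) ^ (cherrySwaps l).card * (1 + X) ^ (cherrySwaps r).card := by
      intro l r
      rw [card_cherrySwaps_node, pow_add, pow_add]
      split_ifs with h
      · rw [h.1, h.2, card_cherrySwaps_leaf]; ring
      · ring
    simp only [h1, sum_add_distrib, sum_mul_sum]
    congr 1
    have h2 : ∀ p : ℕ × ℕ, (∑ l ∈ planeTrees p.1, ∑ r ∈ planeTrees p.2,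
        if l = leaf ∧ r = leaf then (X : ℝ[X]) else 0) = if p = (1, 1) then X else 0 := by
      rintro ⟨i, j⟩
      simp only [ite_and, sum_ite_eq', sum_ite_irrel, sum_const_zero, mem_planeTrees]
      simp only [← ite_and, size, Prod.mk.injEq, eq_comm (a := 1)]
    simp only [h2, sum_ite_eq', HasAntidiagonal.mem_antidiagonal]
    by_cases hn : n = 2
    · subst hn; simp [rootCherryCount]
    · rw [if_neg (by omega)]
      split_ifs with h
      · rw [rootCherryCount, if_neg (by omega)]; simp
      · rfl

end Cherries

section Automorphisms
variable {l r : PTree}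

lemma card_support_straight (g : Perm (Leaf l)) (h : Perm (Leaf r)) :
    (Perm.support (straight g h : Perm (Leaf (node l r)))).card =
      g.support.card + h.support.card := by
  have : Perm.support (straight g h : Perm (Leaf (node l r))) =
      (g.support.disjSum h.support : Finset (Leaf l ⊕ Leaf r)) := by
    ext (x | x)
    · refine Iff.trans (Perm.mem_support (α := Leaf (node l r)))
        (Iff.trans ?_ Finset.inl_mem_disjSum.symm)
      rw [Perm.mem_support]
      exact Sum.inl_injective.ne_iff
    · refine Iff.trans (Perm.mem_support (α := Leaf (node l r)))
        (Iff.trans ?_ Finset.inr_mem_disjSum.symm)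
      rw [Perm.mem_support]
      exact Sum.inr_injective.ne_iff
  rw [this]
  exact card_disjSum _ _

lemma card_support_crossed (g : Leaf l ≃ Leaf r) (h : Leaf r ≃ Leaf l) :
    (Perm.support (crossed g h : Perm (Leaf (node l r)))).card = (node l r).size := by
  have : Perm.support (crossed g h : Perm (Leaf (node l r))) = univ := by
    ext (x | x)
    · exact iff_of_true (Perm.mem_support.mpr Sum.inr_ne_inl) (mem_univ _)
    · exact iff_of_true (Perm.mem_support.mpr Sum.inl_ne_inr) (mem_univ _)
  rw [this, card_univ, card_leaf]

lemma straight_pow (g : Perm (Leaf l)) (h : Perm (Leaf r)) (n : ℕ) :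
    (straight g h : Perm (Leaf (node l r))) ^ n = straight (g ^ n) (h ^ n) := by
  induction n with
  | zero => ext (x | x) <;> rfl
  | succ n ih => rw [pow_succ, ih, pow_succ, pow_succ]; ext (x | x) <;> rfl

lemma pow_two_pow_eq_one_of_le {G : Type*} [Monoid G] {a : G} {m k : ℕ} (h : a ^ 2 ^ m = 1)
    (hk : m ≤ k) : a ^ 2 ^ k = 1 := by
  rw [← Nat.add_sub_cancel' hk, pow_add, pow_mul, h, one_pow]

lemma exists_pow_eq_one {T : PTree} {a : Perm (Leaf T)} (ha : a ∈ isos T T) :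
    ∃ m, a ^ 2 ^ m = 1 := by
  induction T with
  | leaf => exact ⟨0, by ext x; rfl⟩
  | node l r hl hr =>
    have hs : ∀ (g : Perm (Leaf l)) (h : Perm (Leaf r)), g ∈ isos l l → h ∈ isos r r →
        ∃ m, (straight g h : Perm (Leaf (node l r))) ^ 2 ^ m = 1 := by
      intro g h hg hh
      obtain ⟨m, hm⟩ := hl hg
      obtain ⟨k, hk⟩ := hr hh
      refine ⟨max m k, ?_⟩
      rw [straight_pow, pow_two_pow_eq_one_of_le hm (le_max_left _ _),
        pow_two_pow_eq_one_of_le hk (le_max_right _ _)]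
      ext (x | x) <;> rfl
    rw [mem_isos_node] at ha
    rcases ha with ⟨g, hg, h, hh, rfl⟩ | ⟨g, hg, h, hh, rfl⟩
    · exact hs g h hg hh
    · obtain ⟨m, hm⟩ := hs (g.trans h) (h.trans g) (trans_mem_isos hg hh) (trans_mem_isos hh hg)
      refine ⟨m + 1, ?_⟩
      rw [pow_succ', pow_mul, ← hm]
      congr 1
      rw [pow_two]
      ext (x | x) <;> rfl

lemma even_card_support_of_mem_isos {T : PTree} {a : Perm (Leaf T)} (ha : a ∈ isos T T) :
    2 ∣ a.support.card := by
  obtain ⟨m, hm⟩ := exists_pow_eq_one ha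
  exact even_card_support hm

open Polynomial in
lemma sum_card_filter_isos (n k : ℕ) :
    ∑ T ∈ planeTrees n, (((isos T T).filter fun a : Perm (Leaf T) =>
      a.support.card = 2 * k).card : ℝ) = quadCoeff exchangeCount n k := by
  rw [← coeff_eq_quadCoeff exchangeCount
    (fun n => ∑ T ∈ planeTrees n, ∑ a ∈ isos T T, (X : ℝ[X]) ^ ((Perm.support a).card / 2))]
  · simp only [finsetSum_coeff, coeff_X_pow, card_filter, Nat.cast_sum, Nat.cast_ite, Nat.cast_one,
      Nat.cast_zero]
    refine sum_congr rfl fun T _ => sum_congr rfl fun a ha => ?_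
    have := even_card_support_of_mem_isos ha
    refine if_congr ?_ rfl rfl
    omega
  · simp [planeTrees]
  · intro n
    rw [sum_planeTrees, add_assoc]
    congr 1
    · refine if_congr Iff.rfl ?_ rfl
      rw [isos_leaf_leaf, sum_singleton]
      have : (Equiv.refl (Leaf leaf) : Perm (Leaf leaf)) = 1 := rfl
      rw [this, Perm.support_one, card_empty, Nat.zero_div, pow_zero]
    have h1 : ∀ p ∈ antidiagonal n, ∀ l ∈ planeTrees p.1, ∀ r ∈ planeTrees p.2,
        ∑ a ∈ isos (node l r) (node l r), (X : ℝ[X]) ^ ((Perm.support a).card / 2) =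
          X ^ (n / 2) * C (((isos l r).card : ℝ) * (isos r l).card) +
          (∑ a ∈ isos l l, (X : ℝ[X]) ^ ((Perm.support a).card / 2)) *
          ∑ a ∈ isos r r, (X : ℝ[X]) ^ ((Perm.support a).card / 2) := by
      intro p hp l hl r hr
      rw [HasAntidiagonal.mem_antidiagonal] at hp
      rw [mem_planeTrees] at hl hr
      rw [sum_isos_node, add_comm]
      congr 1
      · simp only [card_support_crossed, size, hl, hr, hp, sum_const, nsmul_eq_mul]
        simp only [map_mul, map_natCast]
        ring
      · rw [sum_mul_sum]
        refine sum_congr rfl fun g hg => sum_congr rfl fun h hh => ?_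
        rw [card_support_straight, ← pow_add, Nat.add_div_of_dvd_right
          (even_card_support_of_mem_isos hg)]
    rw [sum_congr rfl fun p hp => sum_congr rfl fun l hl => sum_congr rfl fun r hr =>
      h1 p hp l hl r hr]
    simp only [sum_add_distrib, sum_mul_sum]
    congr 1
    simp only [← mul_sum, ← map_sum]
    have h2 : ∀ p : ℕ × ℕ, p.1 ≠ p.2 → (∑ l ∈ planeTrees p.1, ∑ r ∈ planeTrees p.2,
        ((isos l r).card : ℝ) * (isos r l).card) = 0 := by
      intro p hp
      refine sum_eq_zero fun l hl => sum_eq_zero fun r hr => ?_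
      rw [mem_planeTrees] at hl hr
      rw [Finset.card_eq_zero.mpr, Nat.cast_zero, zero_mul]
      refine eq_empty_of_forall_notMem fun e _ => hp ?_
      rw [← hl, ← hr, size_eq_of_mem_isos e]
    split_ifs with h
    · obtain ⟨⟨m, rfl⟩, hm⟩ := h
      rw [Nat.mul_div_cancel_left _ (by norm_num : 0 < 2)]
      congr 2
      rw [exchangeCount, Nat.sub_add_cancel (by omega), sum_eq_single_of_mem (m, m)]
      · rw [HasAntidiagonal.mem_antidiagonal]; omega
      · rintro ⟨i, j⟩ hp hne
        rw [HasAntidiagonal.mem_antidiagonal] at hp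
        refine h2 _ fun (e : i = j) => hne ?_
        simp only [Prod.mk.injEq]
        simp only at hp
        omega
    · rw [sum_eq_zero, map_zero, mul_zero]
      rintro ⟨i, j⟩ hp
      rw [HasAntidiagonal.mem_antidiagonal] at hp
      by_cases hij : i = j
      · simp only at hp
        obtain rfl : i = 0 := by
          by_contra h0
          exact h ⟨⟨i, by omega⟩, by omega⟩
        simp [planeTrees]
      · exact h2 _ hij

lemma exchangeCount_zero : exchangeCount 0 = 1 := by
  simp [exchangeCount, planeTrees, isos_leaf_leaf]

lemma exchangeCount_nonneg (i : ℕ) : 0 ≤ exchangeCount i :=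
  sum_nonneg fun _ _ => sum_nonneg fun _ _ => by positivity

lemma exchangeCount_le (i : ℕ) : exchangeCount i ≤ 16 ^ i := by
  have h1 : ∀ l ∈ planeTrees (i + 1), ∑ r ∈ planeTrees (i + 1), ((isos l r).card : ℝ) = 2 ^ i := by
    intro l hl
    have := sum_card_isos l (i + 1)
    rw [if_pos (mem_planeTrees.mp hl), Nat.add_sub_cancel] at this
    exact_mod_cast this
  have h2 : ((planeTrees (i + 1)).card : ℝ) ≤ 4 ^ i := by
    rw [card_planeTrees, planeCount_succ, catalan_eq_centralBinom_div]
    have h := (Nat.div_le_self (Nat.centralBinom i) (i + 1)).trans (Nat.centralBinom_le_four_pow i)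
    exact_mod_cast h
  calc exchangeCount i ≤ ∑ l ∈ planeTrees (i + 1), ∑ r ∈ planeTrees (i + 1),
        ((isos l r).card : ℝ) * 2 ^ i := by
        refine sum_le_sum fun l hl => sum_le_sum fun r hr =>
          mul_le_mul_of_nonneg_left ?_ (Nat.cast_nonneg _)
        rw [← h1 r hr]
        exact single_le_sum (f := fun l => ((isos r l).card : ℝ)) (fun _ _ => Nat.cast_nonneg _) hl
    _ = ∑ l ∈ planeTrees (i + 1), (2 : ℝ) ^ i * 2 ^ i := by
        refine sum_congr rfl fun l hl => ?_
        rw [← sum_mul, h1 l hl]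
    _ = (planeTrees (i + 1)).card * 4 ^ i := by
        rw [sum_const, nsmul_eq_mul, ← mul_pow]; norm_num
    _ ≤ 4 ^ i * 4 ^ i := by gcongr
    _ = 16 ^ i := by rw [← mul_pow]; norm_num

end Automorphisms

/-- The normalizing factor in `pairTerm`. -/
lemma mul_quadCoeff_sq_eq {n : ℕ} (hn : 0 < n) (δ : ℕ → ℝ) (k : ℕ) :
    ((n - 2 * k).factorial * 2 ^ k * k.factorial : ℝ) * quadCoeff δ n k ^ 2 =
      n.factorial * planeCount n ^ 2 * pairTerm δ k n := by
  have := planeCount_pos hn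
  rw [pairTerm]
  field_simp

lemma sum_card_homs_self (T S : PTree) :
    ∑ v : Leaf T ≃ Leaf S, (homs v v).card = ∑ a ∈ isos T T, ∑ b ∈ isos S S,
      (univ.filter fun v : Leaf T ≃ Leaf S => v.permCongr a = b).card := by
  simp only [homs, card_filter, sum_product]
  rw [sum_comm]
  refine sum_congr rfl fun a _ => ?_
  rw [sum_comm]
  refine sum_congr rfl fun b _ => sum_congr rfl fun v _ => ?_
  congr 1
  rw [eq_iff_iff]
  constructor
  · intro h
    ext x
    have := Equiv.congr_fun h (v.symm x)
    simpa [permCongr_apply] using this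
  · rintro rfl
    ext x
    simp [permCongr_apply]

lemma sum_card_homs_self_le {n : ℕ} {T S : PTree} (hT : T.size = n) :
    ∑ v : Leaf T ≃ Leaf S, (homs v v).card ≤ ∑ k ∈ range (n + 1),
      (n - 2 * k).factorial * 2 ^ k * k.factorial *
        ((isos T T).filter fun a : Perm (Leaf T) => a.support.card = 2 * k).card *
        ((isos S S).filter fun b : Perm (Leaf S) => b.support.card = 2 * k).card := by
  rw [sum_card_homs_self]
  have hmaps : ∀ a ∈ isos T T, (Perm.support a).card / 2 ∈ range (n + 1) := by
    intro a _
    have := card_le_univ (Perm.support a)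
    rw [card_leaf, hT] at this
    rw [mem_range]
    omega
  rw [← sum_fiberwise_of_maps_to hmaps]
  refine sum_le_sum fun k _ => ?_
  have e : (isos T T).filter (fun a : Perm (Leaf T) => (Perm.support a).card / 2 = k) =
      (isos T T).filter fun a : Perm (Leaf T) => (Perm.support a).card = 2 * k := by
    refine filter_congr fun a ha => ?_
    have := even_card_support_of_mem_isos ha
    omega
  rw [e]
  refine (sum_le_card_nsmul _ _ ((n - 2 * k).factorial * 2 ^ k * k.factorial *
    ((isos S S).filter fun b : Perm (Leaf S) => b.support.card = 2 * k).card) ?_).trans ?_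
  · intro a ha
    rw [mem_filter] at ha
    obtain ⟨m, hm⟩ := exists_pow_eq_one ha.1
    refine (sum_le_sum fun b _ => card_filter_permCongr_le hm ha.2).trans ?_
    rw [← sum_filter, sum_const, card_leaf, hT, smul_eq_mul, mul_comm]
  · rw [smul_eq_mul]
    exact le_of_eq (by ring)

/-- The total number of automorphisms of all triples. -/
noncomputable def autSum (n : ℕ) : ℕ := ∑ t ∈ Triples n, tangleAutCount t.1 t.2.1 t.2.2

lemma autSum_le {n : ℕ} (hn : 0 < n) : (autSum n : ℝ) ≤
    n.factorial * planeCount n ^ 2 * ∑ k ∈ range (n + 1), pairTerm exchangeCount k n := by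
  rw [autSum, sum_triples, mul_sum]
  simp only [tangleAutCount_matchList, ← mul_quadCoeff_sq_eq hn, ← sum_card_filter_isos]
  have h : ∀ T ∈ planeTrees n, ∀ S ∈ planeTrees n,
      ((∑ v : Leaf T ≃ Leaf S, (homs v v).card : ℕ) : ℝ) ≤ ∑ k ∈ range (n + 1),
      ((n - 2 * k).factorial * 2 ^ k * k.factorial : ℝ) *
        ((isos T T).filter fun a : Perm (Leaf T) => a.support.card = 2 * k).card *
        ((isos S S).filter fun b : Perm (Leaf S) => b.support.card = 2 * k).card := by
    intro T hT S _
    exact_mod_cast sum_card_homs_self_le (mem_planeTrees.mp hT)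
  rw [Nat.cast_sum]
  simp only [Nat.cast_sum (planeTrees n)]
  refine (sum_le_sum fun T hT => sum_le_sum fun S hS => h T hT S hS).trans (le_of_eq ?_)
  rw [sum_congr rfl fun T _ => sum_comm, sum_comm]
  refine sum_congr rfl fun k _ => ?_
  rw [pow_two, sum_mul_sum, mul_sum]
  refine sum_congr rfl fun T _ => ?_
  rw [mul_sum]
  exact sum_congr rfl fun S _ => mul_assoc _ _ _

/-- The number of triples with exactly `k` matched cherries. -/
noncomputable def matchedCount (k n : ℕ) : ℕ :=
  ((Triples n).filter fun t => matchedCherries t.1 t.2.1 t.2.2 = k).card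

lemma sum_choose_matchedCherries (n s : ℕ) :
    ∑ t ∈ Triples n, ((matchedCherries t.1 t.2.1 t.2.2).choose s : ℝ) =
      ((n - 2 * s).factorial * 2 ^ s * s.factorial : ℝ) * quadCoeff rootCherryCount n s ^ 2 := by
  rw [sum_triples]
  simp only [matchedCherries_matchList]
  have h : ∀ T ∈ planeTrees n, ∀ S ∈ planeTrees n,
      ∑ v : Leaf T ≃ Leaf S, ((matchedSwaps v).card.choose s : ℝ) =
      ((cherrySwaps T).card.choose s : ℝ) * (cherrySwaps S).card.choose s *
        ((n - 2 * s).factorial * 2 ^ s * s.factorial) := by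
    intro T hT S hS
    have := sum_choose_card_filter s (disjointSwaps_cherrySwaps T) (disjointSwaps_cherrySwaps S)
      (by rw [card_leaf, card_leaf, mem_planeTrees.mp hT, mem_planeTrees.mp hS])
    rw [card_leaf, mem_planeTrees.mp hT] at this
    exact_mod_cast this
  rw [sum_congr rfl fun T hT => sum_congr rfl fun S hS => h T hT S hS]
  rw [← sum_choose_card_cherrySwaps, pow_two, sum_mul_sum, mul_sum]
  refine sum_congr rfl fun T _ => ?_
  rw [mul_sum]
  exact sum_congr rfl fun S _ => mul_comm _ _

lemma card_cherrySwaps_le (T : PTree) : (cherrySwaps T).card < T.size := by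
  induction T with
  | leaf => rw [card_cherrySwaps_leaf]; exact size_pos _
  | node l r hl hr =>
    rw [card_cherrySwaps_node, size]
    split_ifs with h
    · obtain ⟨rfl, rfl⟩ := h
      simp [card_cherrySwaps_leaf, size]
    · omega

lemma matchedCherries_le {n : ℕ} {t : PTree × PTree × List ℕ} (ht : t ∈ Triples n) :
    matchedCherries t.1 t.2.1 t.2.2 ≤ n := by
  obtain ⟨T, hT, S, hS, v, rfl⟩ := mem_triples.mp ht
  rw [matchedCherries_matchList, ← mem_planeTrees.mp hT]
  exact (card_filter_le _ _).trans (card_cherrySwaps_le T).le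

lemma sum_alternating_choose {m n : ℕ} (h : m ≤ n) (k : ℕ) :
    ∑ s ∈ range (n + 1), (-1 : ℝ) ^ s * ((s + k).choose k * m.choose (s + k)) =
      if m = k then 1 else 0 := by
  rcases lt_or_ge m k with hmk | hmk
  · rw [if_neg hmk.ne]
    refine sum_eq_zero fun s _ => ?_
    rw [Nat.choose_eq_zero_of_lt (by omega : m < s + k)]
    simp
  · have e : ∀ s, ((s + k).choose k * m.choose (s + k) : ℝ) = m.choose k * (m - k).choose s := by
      intro s
      rcases le_or_gt (s + k) m with hs | hs
      · have := Nat.choose_mul (n := m) (k := s + k) (s := k) (by omega)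
        rw [Nat.add_sub_cancel, mul_comm] at this
        exact_mod_cast this
      · rw [Nat.choose_eq_zero_of_lt hs, Nat.choose_eq_zero_of_lt (by omega : m - k < s)]
        simp
    have e2 : ∑ s ∈ range (m - k + 1), (-1 : ℝ) ^ s * (m - k).choose s =
        if m - k = 0 then 1 else 0 := by
      exact_mod_cast @Int.alternating_sum_range_choose (m - k)
    have e3 : ∑ s ∈ range (n + 1), (-1 : ℝ) ^ s * (m - k).choose s =
        ∑ s ∈ range (m - k + 1), (-1 : ℝ) ^ s * (m - k).choose s := by
      symm
      refine sum_subset (range_subset_range.mpr (by omega)) fun s _ hs => ?_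
      rw [mem_range, not_lt] at hs
      rw [Nat.choose_eq_zero_of_lt (by omega)]
      simp
    simp only [e, mul_left_comm _ (m.choose k : ℝ)]
    rw [← mul_sum, e3, e2]
    rcases eq_or_lt_of_le hmk with rfl | hlt
    · simp
    · rw [if_neg (by omega), if_neg (by omega), mul_zero]

lemma matchedCount_eq {n : ℕ} (hn : 0 < n) (k : ℕ) : (matchedCount k n : ℝ) =
    n.factorial * planeCount n ^ 2 * ∑ s ∈ range (n + 1),
      (-1 : ℝ) ^ s * ((s + k).choose k : ℝ) * pairTerm rootCherryCount (s + k) n := by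
  rw [matchedCount, card_filter, Nat.cast_sum]
  have h : ∀ t ∈ Triples n, ((if matchedCherries t.1 t.2.1 t.2.2 = k then 1 else 0 : ℕ) : ℝ) =
      ∑ s ∈ range (n + 1), (-1 : ℝ) ^ s * ((s + k).choose k *
        (matchedCherries t.1 t.2.1 t.2.2).choose (s + k)) := by
    intro t ht
    rw [sum_alternating_choose (matchedCherries_le ht)]
    push_cast
    rfl
  rw [sum_congr rfl h, sum_comm, mul_sum]
  refine sum_congr rfl fun s _ => ?_
  rw [mul_left_comm, ← mul_quadCoeff_sq_eq hn, ← sum_choose_matchedCherries, ← mul_sum, ← mul_sum,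
    mul_assoc]

lemma two_pow_le_tangleAutCount {n : ℕ} {t : PTree × PTree × List ℕ} (ht : t ∈ Triples n) :
    2 ^ matchedCherries t.1 t.2.1 t.2.2 ≤ tangleAutCount t.1 t.2.1 t.2.2 := by
  obtain ⟨T, hT, S, hS, v, rfl⟩ := mem_triples.mp ht
  rw [matchedCherries_matchList, tangleAutCount_matchList]
  exact card_matchedSwaps_le v

/-- The number of triples with exactly `k` matched cherries and `2 ^ k` automorphisms. -/
noncomputable def inducedCount (k n : ℕ) : ℕ :=
  ((Triples n).filter fun t => matchedCherries t.1 t.2.1 t.2.2 = k ∧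
    tangleAutCount t.1 t.2.1 t.2.2 = 2 ^ k).card

lemma inducedCount_le (k n : ℕ) : inducedCount k n ≤ matchedCount k n :=
  card_le_card (monotone_filter_right _ fun _ _ h => h.1)

lemma le_autSum (K n : ℕ) : ∑ k ∈ range K,
    (2 ^ k * matchedCount k n + (matchedCount k n - inducedCount k n)) ≤ autSum n := by
  have h1 : ∀ k, 2 ^ k * matchedCount k n + (matchedCount k n - inducedCount k n) ≤
      ∑ t ∈ (Triples n).filter (fun t => matchedCherries t.1 t.2.1 t.2.2 = k),
        tangleAutCount t.1 t.2.1 t.2.2 := by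
    intro k
    have e : matchedCount k n = inducedCount k n + ((Triples n).filter fun t =>
        matchedCherries t.1 t.2.1 t.2.2 = k ∧ tangleAutCount t.1 t.2.1 t.2.2 ≠ 2 ^ k).card := by
      rw [matchedCount, inducedCount, ← filter_filter, ← filter_filter]
      exact (card_filter_add_card_filter_not _).symm
    rw [e, Nat.add_sub_cancel_left, ← e, matchedCount, ← filter_filter, card_filter _ (filter _ _),
      mul_comm, ← smul_eq_mul, ← sum_const, ← sum_add_distrib]
    refine sum_le_sum fun t ht => ?_
    rw [mem_filter] at ht
    have := two_pow_le_tangleAutCount ht.1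
    rw [ht.2] at this
    split_ifs with h <;> omega
  refine (sum_le_sum fun k _ => h1 k).trans ?_
  rw [autSum, sum_fiberwise_eq_sum_filter]
  exact sum_le_sum_of_subset (filter_subset _ _)

lemma card_homs_self_eq {T S T' S' : PTree} {v : Leaf T ≃ Leaf S} {v' : Leaf T' ≃ Leaf S'}
    (h : (homs v v').Nonempty) : (homs v v).card = (homs v' v').card := by
  rw [card_homs_eq h, ← card_homs_eq (w := v') h]
  exact card_bij' (fun q _ => (q.1.symm, q.2.symm)) (fun q _ => (q.1.symm, q.2.symm))
    (fun q hq => symm_mem_homs hq) (fun q hq => symm_mem_homs hq) (fun q _ => rfl) (fun q _ => rfl)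

lemma tangleProb_eq_of_comp (n : ℕ) (P : ℕ → ℕ → Prop) [∀ m a, Decidable (P m a)] :
    tangleProb n (fun t => P (matchedCherries t.1 t.2.1 t.2.2) (tangleAutCount t.1 t.2.1 t.2.2)) =
      (∑ t ∈ (Triples n).filter fun t =>
        P (matchedCherries t.1 t.2.1 t.2.2) (tangleAutCount t.1 t.2.1 t.2.2),
        tangleAutCount t.1 t.2.1 t.2.2 : ℕ) / autSum n := by
  refine (tangleProb_eq n _ fun v v' h hP => ?_).trans (by rw [autSum]; congr!)
  simp only [matchedCherries_matchList, tangleAutCount_matchList] at hP ⊢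
  obtain ⟨p, hp⟩ := h
  rwa [← card_homs_self_eq ⟨p, hp⟩, ← (matchedSwaps_le_of_homs ⟨p, hp⟩).antisymm
    (matchedSwaps_le_of_homs ⟨_, symm_mem_homs hp⟩)]

lemma sum_induced_eq (k n : ℕ) :
    ∑ t ∈ (Triples n).filter (fun t => matchedCherries t.1 t.2.1 t.2.2 = k ∧
      tangleAutCount t.1 t.2.1 t.2.2 = 2 ^ k), tangleAutCount t.1 t.2.1 t.2.2 =
      2 ^ k * inducedCount k n := by
  rw [inducedCount, mul_comm, ← smul_eq_mul, ← sum_const]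
  exact sum_congr rfl fun t ht => (mem_filter.mp ht).2.2

lemma tangleProb_matched_eq (k n : ℕ) :
    tangleProb n (fun t => matchedCherries t.1 t.2.1 t.2.2 = k ∧
      tangleAutCount t.1 t.2.1 t.2.2 = 2 ^ k) = 2 ^ k * inducedCount k n / autSum n := by
  rw [tangleProb_eq_of_comp n fun m a => m = k ∧ a = 2 ^ k, sum_induced_eq]
  push_cast
  rfl

lemma tangleProb_induced_le (n : ℕ) :
    tangleProb n (fun t => tangleAutCount t.1 t.2.1 t.2.2 =
      2 ^ matchedCherries t.1 t.2.1 t.2.2) ≤ 1 := by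
  rw [tangleProb_eq_of_comp n fun m a => a = 2 ^ m]
  refine div_le_one_of_le₀ ?_ (Nat.cast_nonneg _)
  exact_mod_cast sum_le_sum_of_subset (filter_subset _ _)

lemma sum_tangleProb_le (K n : ℕ) :
    ∑ k ∈ range K, tangleProb n (fun t => matchedCherries t.1 t.2.1 t.2.2 = k ∧
      tangleAutCount t.1 t.2.1 t.2.2 = 2 ^ k) ≤
    tangleProb n (fun t => tangleAutCount t.1 t.2.1 t.2.2 =
      2 ^ matchedCherries t.1 t.2.1 t.2.2) := by
  rw [tangleProb_eq_of_comp n fun m a => a = 2 ^ m]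
  rw [sum_congr rfl fun k _ => tangleProb_eq_of_comp n fun m a => m = k ∧ a = 2 ^ k, ← sum_div]
  refine div_le_div_of_nonneg_right ?_ (Nat.cast_nonneg _)
  rw [← Nat.cast_sum, Nat.cast_le]
  have e : ∀ k, (Triples n).filter (fun t => matchedCherries t.1 t.2.1 t.2.2 = k ∧
      tangleAutCount t.1 t.2.1 t.2.2 = 2 ^ k) = ((Triples n).filter fun t =>
      tangleAutCount t.1 t.2.1 t.2.2 = 2 ^ matchedCherries t.1 t.2.1 t.2.2).filter
        fun t => matchedCherries t.1 t.2.1 t.2.2 = k := by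
    intro k
    rw [filter_filter]
    refine filter_congr fun t _ => ?_
    constructor
    · rintro ⟨rfl, h⟩
      exact ⟨h, rfl⟩
    · rintro ⟨h, rfl⟩
      exact ⟨rfl, h⟩
  simp only [e]
  rw [sum_fiberwise_eq_sum_filter]
  exact sum_le_sum_of_subset (filter_subset _ _)

end PTree

section Squeeze

open Finset Filter Topology

variable {p : ℕ → ℝ} {x y : ℕ → ℕ → ℝ} {Z U : ℕ → ℝ} {c : ℝ}

lemma tendsto_of_sum_le (hx : ∀ k, Tendsto (x k) atTop (𝓝 (p k)))
    (hyx : ∀ k, ∀ᶠ n in atTop, y k n ≤ x k n)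
    (hZ : ∀ K, ∀ᶠ n in atTop, ∑ k ∈ range K, (2 ^ k * x k n + (x k n - y k n)) ≤ Z n)
    (hZU : ∀ᶠ n in atTop, Z n ≤ U n) (hU : Tendsto U atTop (𝓝 c))
    (hp : HasSum (fun k => 2 ^ k * p k) c) :
    Tendsto Z atTop (𝓝 c) ∧ ∀ k, Tendsto (y k) atTop (𝓝 (p k)) := by
  have hlim : ∀ K, Tendsto (fun n => ∑ k ∈ range K, 2 ^ k * x k n) atTop
      (𝓝 (∑ k ∈ range K, 2 ^ k * p k)) :=
    fun K => tendsto_finsetSum _ fun k _ => (hx k).const_mul _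
  have hyx' : ∀ K, ∀ᶠ n in atTop, ∀ k ∈ range K, y k n ≤ x k n :=
    fun K => (eventually_all_finset _).mpr fun k _ => hyx k
  refine ⟨tendsto_order.mpr ⟨fun a ha => ?_, fun a ha => ?_⟩,
    fun k => tendsto_order.mpr ⟨fun a ha => ?_, fun a ha => ?_⟩⟩
  · obtain ⟨K, hK⟩ := (hp.tendsto_sum_nat.eventually_const_lt ha).exists
    filter_upwards [(hlim K).eventually_const_lt hK, hZ K, hyx' K] with n h1 h2 h3
    refine h1.trans_le (le_trans (sum_le_sum fun k hk => ?_) h2)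
    linarith [h3 k hk]
  · filter_upwards [hZU, hU.eventually_lt_const ha] with n h1 h2 using h1.trans_lt h2
  · have h : Tendsto (fun K => p k - (c - ∑ j ∈ range K, 2 ^ j * p j)) atTop
        (𝓝 (p k - (c - c))) := tendsto_const_nhds.sub (tendsto_const_nhds.sub hp.tendsto_sum_nat)
    rw [sub_self, sub_zero] at h
    obtain ⟨K, hK, hkK⟩ := ((h.eventually_const_lt ha).and (eventually_gt_atTop k)).exists
    have h' := (hx k).sub (hU.sub (hlim K))
    filter_upwards [h'.eventually_const_lt hK, hZ K, hyx' K, hZU] with n h1 h2 h3 h4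
    have h5 : x k n - y k n ≤ ∑ j ∈ range K, (x j n - y j n) :=
      single_le_sum (f := fun j => x j n - y j n) (fun j hj => sub_nonneg.mpr (h3 j hj))
        (mem_range.mpr hkK)
    rw [sum_add_distrib] at h2
    linarith
  · filter_upwards [hyx k, (hx k).eventually_lt_const ha] with n h1 h2 using h1.trans_lt h2

lemma hasSum_pow_div_factorial (a : ℝ) :
    HasSum (fun k : ℕ => a ^ k / k.factorial) (Real.exp a) := by
  rw [Real.exp_eq_exp_ℝ]
  exact NormedSpace.expSeries_div_hasSum_exp a

end Squeeze

namespace PTree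

open Finset Filter Topology

lemma rootCherryCount_zero : rootCherryCount 0 = 1 := by simp [rootCherryCount]

lemma rootCherryCount_nonneg (i : ℕ) : 0 ≤ rootCherryCount i := by
  rw [rootCherryCount]; positivity

lemma rootCherryCount_le (i : ℕ) : rootCherryCount i ≤ 16 ^ i := by
  rw [rootCherryCount]
  split_ifs
  · exact one_le_pow₀ (by norm_num)
  · positivity

lemma tendsto_counts :
    Tendsto (fun n => (autSum n : ℝ) / (n.factorial * planeCount n ^ 2)) atTop
      (𝓝 (Real.exp (1 / 8))) ∧
    ∀ k, Tendsto (fun n => (inducedCount k n : ℝ) / (n.factorial * planeCount n ^ 2)) atTop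
      (𝓝 (Real.exp (-(1 / 8)) * (1 / 8) ^ k / k.factorial)) := by
  have hQ : ∀ {n : ℕ}, 0 < n → 0 < (n.factorial * planeCount n ^ 2 : ℝ) := fun hn => by
    have := planeCount_pos hn
    positivity
  have hQ' : ∀ n : ℕ, 0 ≤ (n.factorial * planeCount n ^ 2 : ℝ) := fun n => by positivity
  refine tendsto_of_sum_le
    (x := fun k n => (matchedCount k n : ℝ) / (n.factorial * planeCount n ^ 2))
    (U := fun n => ∑ k ∈ range (n + 1), pairTerm exchangeCount k n)
    (fun k => ?_) (fun k => ?_) (fun K => ?_) ?_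
    (tendsto_tsum_pairTerm exchangeCount_zero exchangeCount_nonneg exchangeCount_le) ?_
  · refine (tendsto_inclusion_exclusion rootCherryCount_zero rootCherryCount_nonneg
      rootCherryCount_le k).congr' ?_
    filter_upwards [eventually_gt_atTop 0] with n hn
    rw [matchedCount_eq hn, mul_div_cancel_left₀ _ (hQ hn).ne']
  · refine .of_forall fun n => div_le_div_of_nonneg_right ?_ (hQ' n)
    exact_mod_cast inducedCount_le k n
  · refine .of_forall fun n => ?_
    simp only [← mul_div_assoc, ← sub_div, ← add_div, ← sum_div]
    refine div_le_div_of_nonneg_right ?_ (hQ' n)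
    refine le_trans (le_of_eq ?_) (Nat.cast_le.mpr (le_autSum K n))
    push_cast [inducedCount_le]
    rfl
  · filter_upwards [eventually_gt_atTop 0] with n hn
    rw [div_le_iff₀' (hQ hn)]
    exact autSum_le hn
  · have h := (hasSum_pow_div_factorial (1 / 4)).mul_left (Real.exp (-(1 / 8)))
    rw [← Real.exp_add, show -(1 / 8 : ℝ) + 1 / 4 = 1 / 8 by norm_num] at h
    have e : (fun k : ℕ => (2 : ℝ) ^ k * (Real.exp (-(1 / 8)) * (1 / 8) ^ k / k.factorial)) =
        fun k : ℕ => Real.exp (-(1 / 8)) * ((1 / 4) ^ k / k.factorial) := funext fun k => by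
      rw [show (1 / 4 : ℝ) = 2 * (1 / 8) by norm_num, mul_pow]
      ring
    rw [e]
    exact h

lemma tendsto_tangleProb (k : ℕ) :
    Tendsto (fun n => tangleProb n (fun t => matchedCherries t.1 t.2.1 t.2.2 = k ∧
      tangleAutCount t.1 t.2.1 t.2.2 = 2 ^ k)) atTop
      (𝓝 (Real.exp (-(1 / 4)) * (1 / 4 : ℝ) ^ k / (Nat.factorial k : ℝ))) := by
  have h := ((tendsto_counts.2 k).const_mul (2 ^ k)).div tendsto_counts.1 (Real.exp_pos _).ne'
  have e : 2 ^ k * (Real.exp (-(1 / 8)) * (1 / 8) ^ k / k.factorial) / Real.exp (1 / 8) =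
      Real.exp (-(1 / 4)) * (1 / 4 : ℝ) ^ k / (Nat.factorial k : ℝ) := by
    rw [show -(1 / 4 : ℝ) = -(1 / 8) - 1 / 8 by norm_num, Real.exp_sub,
      show (1 / 4 : ℝ) = 2 * (1 / 8) by norm_num, mul_pow]
    ring
  rw [e] at h
  refine h.congr' ?_
  filter_upwards [eventually_gt_atTop 0] with n hn
  have := planeCount_pos hn
  rw [tangleProb_matched_eq, Pi.div_apply, ← mul_div_assoc,
    div_div_div_cancel_right₀ (by positivity)]

lemma tendsto_tangleProb_induced :
    Tendsto (fun n => tangleProb n (fun t => tangleAutCount t.1 t.2.1 t.2.2 =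
      2 ^ matchedCherries t.1 t.2.1 t.2.2)) atTop (𝓝 1) := by
  have hsum : HasSum (fun k : ℕ => Real.exp (-(1 / 4)) * (1 / 4 : ℝ) ^ k / (Nat.factorial k : ℝ))
      1 := by
    have h := (hasSum_pow_div_factorial (1 / 4)).mul_left (Real.exp (-(1 / 4)))
    rw [← Real.exp_add, neg_add_cancel, Real.exp_zero] at h
    simpa only [mul_div_assoc] using h
  refine tendsto_order.mpr ⟨fun a ha => ?_, fun a ha => ?_⟩
  · obtain ⟨K, hK⟩ := (hsum.tendsto_sum_nat.eventually_const_lt ha).exists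
    have hlim := tendsto_finsetSum (range K) fun k _ => tendsto_tangleProb k
    filter_upwards [hlim.eventually_const_lt hK] with n hn
    exact hn.trans_le (sum_tangleProb_le K n)
  · exact .of_forall fun n => (tangleProb_induced_le n).trans_lt ha

end PTree

open PTree in
/-- Theorem 8 (second part): the probability that a random tanglegram of size `n` has
exactly `k` matched cherries and no automorphisms beyond the `2^k` induced by them also
converges to `e^(-1/4) 4^(-k)/k!`; hence with high probability all automorphisms of a
random tanglegram are induced by matched cherries. -/
theorem matched_cherries_with_only_induced_automorphisms :
    (∀ k : ℕ, Filter.Tendsto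
      (fun n : ℕ => tangleProb n
        (fun t => matchedCherries t.1 t.2.1 t.2.2 = k ∧
          tangleAutCount t.1 t.2.1 t.2.2 = 2 ^ k))
      Filter.atTop
      (nhds (Real.exp (-(1 / 4)) * (1 / 4 : ℝ) ^ k / (Nat.factorial k : ℝ)))) ∧
    Filter.Tendsto
      (fun n : ℕ => tangleProb n
        (fun t => tangleAutCount t.1 t.2.1 t.2.2
          = 2 ^ matchedCherries t.1 t.2.1 t.2.2))
      Filter.atTop (nhds 1) :=
  ⟨tendsto_tangleProb, tendsto_tangleProb_induced⟩
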